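/- arXiv:2503.20381 — 2 statements merged into one kernel-verified Lean document; each statement's English description precedes it below -/
import Mathlib

section
/- Let μ be a measure as in the context with μ(ℝ) = ∞, and let f be of bistable type with ∫₀¹ f(s) ds > 0. Then there exist ε₀ ∈ (0,1] and c̄ > 0 such that for every ε ∈ (0, ε₀] and every pair (c, u) with c > 0 and u ∈ C²(ℝ) bounded, monotone nonincreasing, satisfying −c u'(x) = ∫_{|z| ≥ ε} (u(x+z) − u(x)) dμ(z) + f(u(x)) for every x ∈ ℝ, lim_{x→−∞} u(x) = 1 and lim_{x→+∞} u(x) = 0, one has c ≤ c̄. -/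
open MeasureTheory Filter Topology Set

/-- Truncated nonlocal operator `D_{μ,δ} u (x) = ∫_{|z| ≥ δ} (u(x+z) − u(x)) dμ(z)`. -/
noncomputable def Dtrunc (μ : Measure ℝ) (u : ℝ → ℝ) (δ : ℝ) (x : ℝ) : ℝ :=
  ∫ z in {z : ℝ | δ ≤ |z|}, (u (x + z) - u x) ∂μ

/-- The principal value `D_μ u (x)` exists and equals `L`. -/
def HasPV (μ : Measure ℝ) (u : ℝ → ℝ) (x : ℝ) (L : ℝ) : Prop :=
  Tendsto (fun δ => Dtrunc μ u δ x) (𝓝[>] (0 : ℝ)) (𝓝 L)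

/-- A symmetric diffuse Lévy measure as in the paper. -/
structure LevyMeasure (μ : Measure ℝ) : Prop where
  symm : Measure.map (fun z : ℝ => -z) μ = μ
  moment : ∫⁻ z, ENNReal.ofReal (min 1 (z ^ 2)) ∂μ < ⊤
  diffuse : ∀ x : ℝ, x ≠ 0 → μ {x} = 0

/-- A bistable nonlinearity with threshold `θ`. -/
structure Bistable (f : ℝ → ℝ) (θ : ℝ) : Prop where
  smooth : ContDiff ℝ 1 f
  f0 : f 0 = 0
  f1 : f 1 = 0
  df1 : deriv f 1 < 0
  θ_mem : θ ∈ Set.Ioo (0 : ℝ) 1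
  df0 : deriv f 0 < 0
  neg : ∀ s ∈ Set.Ioo (0 : ℝ) θ, f s < 0
  fθ : f θ = 0
  pos : ∀ s ∈ Set.Ioo θ (1 : ℝ), 0 < f s
  dfθ : 0 < deriv f θ

/-- An ignition nonlinearity with threshold `θ`. -/
structure Ignition (f : ℝ → ℝ) (θ : ℝ) : Prop where
  smooth : ContDiff ℝ 1 f
  f1 : f 1 = 0
  df1 : deriv f 1 < 0
  θ_mem : θ ∈ Set.Ioo (0 : ℝ) 1
  zero : ∀ s ∈ Set.Icc (0 : ℝ) θ, f s = 0
  pos : ∀ s ∈ Set.Ioo θ (1 : ℝ), 0 < f s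

/-- A monostable nonlinearity. -/
structure Monostable (f : ℝ → ℝ) : Prop where
  smooth : ContDiff ℝ 1 f
  f0 : f 0 = 0
  f1 : f 1 = 0
  df1 : deriv f 1 < 0
  pos : ∀ s ∈ Set.Ioo (0 : ℝ) 1, 0 < f s


/-- Explicit supersolution profile. -/
noncomputable def wprof (δ κ x : ℝ) : ℝ := δ + 1 / 2 - Real.arctan (κ * x) / Real.pi

lemma wprof_lower (δ κ x : ℝ) : δ < wprof δ κ x := by
  have h := Real.arctan_lt_pi_div_two (κ * x)
  have hp := Real.pi_pos
  have : Real.arctan (κ * x) / Real.pi < 1 / 2 := by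
    rw [div_lt_iff₀ hp]; linarith
  unfold wprof; linarith

lemma wprof_upper (δ κ x : ℝ) : wprof δ κ x < 1 + δ := by
  have h := Real.neg_pi_div_two_lt_arctan (κ * x)
  have hp := Real.pi_pos
  have : -(1 / 2) < Real.arctan (κ * x) / Real.pi := by
    rw [lt_div_iff₀ hp]; linarith
  unfold wprof; linarith

lemma wprof_cont (δ κ : ℝ) : Continuous (wprof δ κ) := by
  unfold wprof
  have := Real.continuous_arctan
  fun_prop

lemma wprof_hasDeriv (δ κ x : ℝ) :
    HasDerivAt (wprof δ κ) (-(κ / (Real.pi * (1 + (κ * x) ^ 2)))) x := by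
  have h1 : HasDerivAt (fun x => κ * x) κ x := by
    simpa using (hasDerivAt_id x).const_mul κ
  have h2 := ((h1.arctan).div_const Real.pi).const_sub (δ + 1 / 2)
  have e : κ / (Real.pi * (1 + (κ * x) ^ 2)) = 1 / (1 + (κ * x) ^ 2) * κ / Real.pi := by
    rw [one_div, mul_comm Real.pi, ← div_div, div_eq_mul_inv κ, mul_comm κ]
  rw [e]
  exact h2

lemma wprof_top (δ κ : ℝ) (hκ : 0 < κ) : Tendsto (wprof δ κ) atTop (𝓝 δ) := by
  have h1 : Tendsto (fun x => κ * x) atTop atTop := tendsto_id.const_mul_atTop hκ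
  have h2 := (Real.tendsto_arctan_atTop.mono_right nhdsWithin_le_nhds).comp h1
  have h3 := (h2.div_const Real.pi).const_sub (δ + 1 / 2)
  have e : δ + 1 / 2 - Real.pi / 2 / Real.pi = δ := by
    have := Real.pi_pos.ne'
    field_simp; ring
  rw [e] at h3
  exact h3

lemma wprof_bot (δ κ : ℝ) (hκ : 0 < κ) : Tendsto (wprof δ κ) atBot (𝓝 (1 + δ)) := by
  have h1 : Tendsto (fun x => κ * x) atBot atBot := tendsto_id.const_mul_atBot hκ
  have h2 := (Real.tendsto_arctan_atBot.mono_right nhdsWithin_le_nhds).comp h1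
  have h3 := (h2.div_const Real.pi).const_sub (δ + 1 / 2)
  have e : δ + 1 / 2 - -(Real.pi / 2) / Real.pi = 1 + δ := by
    have := Real.pi_pos.ne'
    field_simp; ring
  rw [e] at h3
  exact h3

lemma inv_lip (x y : ℝ) : |1 / (1 + x ^ 2) - 1 / (1 + y ^ 2)| ≤ |x - y| := by
  have hx : 0 < 1 + x ^ 2 := by positivity
  have hy : 0 < 1 + y ^ 2 := by positivity
  have e : 1 / (1 + x ^ 2) - 1 / (1 + y ^ 2)
      = (y - x) * ((x + y) / ((1 + x ^ 2) * (1 + y ^ 2))) := by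
    field_simp; ring
  rw [e, abs_mul, abs_sub_comm y x]
  have : |(x + y) / ((1 + x ^ 2) * (1 + y ^ 2))| ≤ 1 := by
    rw [abs_div, abs_of_pos (mul_pos hx hy), div_le_one (mul_pos hx hy), abs_le]
    constructor <;> nlinarith [sq_nonneg (x * y), sq_nonneg (x + 1), sq_nonneg (y + 1),
      sq_nonneg (x - 1), sq_nonneg (y - 1)]
  exact mul_le_of_le_one_right (abs_nonneg _) this

lemma arctan_taylor (a z : ℝ) :
    |Real.arctan (a + z) - Real.arctan a - z / (1 + a ^ 2)| ≤ z ^ 2 := by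
  have hd : ∀ t ∈ uIcc a (a + z), HasDerivWithinAt
      (fun t => Real.arctan t - t / (1 + a ^ 2)) (1 / (1 + t ^ 2) - 1 / (1 + a ^ 2))
      (uIcc a (a + z)) t := by
    intro t _
    exact ((Real.hasDerivAt_arctan t).sub ((hasDerivAt_id t).div_const _)).hasDerivWithinAt
  have hb : ∀ t ∈ uIcc a (a + z), ‖1 / (1 + t ^ 2) - 1 / (1 + a ^ 2)‖ ≤ |z| := by
    intro t ht
    rw [Real.norm_eq_abs]
    refine (inv_lip t a).trans ?_
    have := abs_sub_left_of_mem_uIcc ht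
    simpa using this
  have h := (convex_uIcc a (a + z)).norm_image_sub_le_of_norm_hasDerivWithin_le hd hb
    left_mem_uIcc right_mem_uIcc
  simp only [Real.norm_eq_abs, add_sub_cancel_left, abs_mul_abs_self] at h
  rw [← sq] at h
  convert h using 2
  ring

lemma wprof_second (δ κ x z : ℝ) :
    |(wprof δ κ (x + z) - wprof δ κ x) + (wprof δ κ (x + -z) - wprof δ κ x)|
      ≤ 2 * min 1 (κ ^ 2 * z ^ 2) := by
  rw [mul_min_of_nonneg _ _ (by norm_num : (0:ℝ) ≤ 2)]
  apply le_min
  · have := wprof_lower δ κ x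
    have := wprof_lower δ κ (x + z)
    have := wprof_lower δ κ (x + -z)
    have := wprof_upper δ κ x
    have := wprof_upper δ κ (x + z)
    have := wprof_upper δ κ (x + -z)
    rw [abs_le]; constructor <;> linarith
  · have h1 := arctan_taylor (κ * x) (κ * z)
    have h2 := arctan_taylor (κ * x) (-(κ * z))
    have e : (wprof δ κ (x + z) - wprof δ κ x) + (wprof δ κ (x + -z) - wprof δ κ x)
      = -((Real.arctan (κ * x + κ * z) - Real.arctan (κ * x) - κ * z / (1 + (κ * x) ^ 2))
        + (Real.arctan (κ * x + -(κ * z)) - Real.arctan (κ * x) - -(κ * z) / (1 + (κ * x) ^ 2)))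
         / Real.pi := by
      unfold wprof
      rw [show κ * (x + z) = κ * x + κ * z by ring,
        show κ * (x + -z) = κ * x + -(κ * z) by ring]
      ring
    rw [e, abs_div, abs_neg, abs_of_pos Real.pi_pos, div_le_iff₀ Real.pi_pos]
    refine (abs_add_le _ _).trans ((add_le_add h1 h2).trans ?_)
    have := Real.pi_gt_three
    nlinarith [mul_nonneg (sq_nonneg κ) (sq_nonneg z)]

lemma moment_integrable (μ : Measure ℝ) (hμ : LevyMeasure μ) :
    Integrable (fun z : ℝ => min 1 (z ^ 2)) μ := by
  refine ⟨by fun_prop, ?_⟩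
  rw [hasFiniteIntegral_iff_ofReal]
  · exact hμ.moment
  · exact Eventually.of_forall fun z => by positivity

lemma moment_small (μ : Measure ℝ) (hμ : LevyMeasure μ) (η : ℝ) (hη : 0 < η) :
    ∃ κ : ℝ, 0 < κ ∧ Integrable (fun z : ℝ => min 1 (κ ^ 2 * z ^ 2)) μ ∧
      ∫ z, min 1 (κ ^ 2 * z ^ 2) ∂μ < η := by
  have hI := moment_integrable μ hμ
  have hb : ∀ κ ∈ Ioo (0:ℝ) 1, ∀ z : ℝ, ‖min 1 (κ ^ 2 * z ^ 2)‖ ≤ min 1 (z ^ 2) := by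
    intro κ hκ z
    rw [Real.norm_of_nonneg (by positivity)]
    have : κ ^ 2 ≤ 1 := by nlinarith [hκ.1, hκ.2]
    exact min_le_min le_rfl (mul_le_of_le_one_left (sq_nonneg z) this)
  have hmem : ∀ᶠ κ in 𝓝[>] (0:ℝ), κ ∈ Ioo (0:ℝ) 1 := Ioo_mem_nhdsGT one_pos
  have ht : Tendsto (fun κ : ℝ => ∫ z, min 1 (κ ^ 2 * z ^ 2) ∂μ) (𝓝[>] 0)
      (𝓝 (∫ z, (0:ℝ) ∂μ)) := by
    refine tendsto_integral_filter_of_dominated_convergence (fun z => min 1 (z ^ 2)) ?_ ?_ hI ?_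
    · exact Eventually.of_forall fun κ => by fun_prop
    · filter_upwards [hmem] with κ hκ
      exact Eventually.of_forall (hb κ hκ)
    · refine Eventually.of_forall fun z => ?_
      have hc : Continuous (fun κ : ℝ => min 1 (κ ^ 2 * z ^ 2)) := by fun_prop
      have := hc.tendsto 0
      simp only [ne_eq, OfNat.ofNat_ne_zero, not_false_eq_true, zero_pow, zero_mul] at this
      rw [min_eq_right zero_le_one] at this
      exact this.mono_left nhdsWithin_le_nhds
  simp only [integral_zero] at ht
  obtain ⟨κ, h1, h2⟩ := ((ht.eventually (gt_mem_nhds hη)).and hmem).exists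
  refine ⟨κ, h2.1, ?_, h1⟩
  exact hI.mono' (by fun_prop) (Eventually.of_forall (hb κ h2))

lemma trunc_finite (μ : Measure ℝ) (hμ : LevyMeasure μ) (ε : ℝ) (h0 : 0 < ε) (h1 : ε ≤ 1) :
    μ {z : ℝ | ε ≤ |z|} < ⊤ := by
  refine lt_of_le_of_lt (measure_mono ?_)
    ((moment_integrable μ hμ).measure_ge_lt_top (show 0 < ε ^ 2 by positivity))
  intro z hz
  simp only [mem_ofPred_eq] at hz ⊢
  apply le_min
  · nlinarith
  · rw [← sq_abs z]; gcongr

lemma trunc_meas (ε : ℝ) : MeasurableSet {z : ℝ | ε ≤ |z|} :=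
  measurableSet_le measurable_const (by fun_prop)

lemma trunc_integrable (μ : Measure ℝ) (hμ : LevyMeasure μ) (ε : ℝ) (h0 : 0 < ε) (h1 : ε ≤ 1)
    (v : ℝ → ℝ) (hv : Continuous v) (M : ℝ) (hM : ∀ x, |v x| ≤ M) (x : ℝ) :
    IntegrableOn (fun z => v (x + z) - v x) {z : ℝ | ε ≤ |z|} μ := by
  have : IsFiniteMeasure (μ.restrict {z : ℝ | ε ≤ |z|}) :=
    ⟨by simpa using trunc_finite μ hμ ε h0 h1⟩
  have hm : Continuous (fun z => v (x + z) - v x) := by fun_prop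
  refine Integrable.of_bound hm.aestronglyMeasurable (2 * M) (Eventually.of_forall fun z => ?_)
  rw [Real.norm_eq_abs]
  refine (abs_sub _ _).trans ?_
  linarith [hM (x + z), hM x]

lemma wprof_D (μ : Measure ℝ) (hμ : LevyMeasure μ) (δ κ : ℝ) (hδ : 0 < δ)
    (hI : Integrable (fun z : ℝ => min 1 (κ ^ 2 * z ^ 2)) μ)
    (ε : ℝ) (h0 : 0 < ε) (h1 : ε ≤ 1) (x : ℝ) :
    ∫ z in {z : ℝ | ε ≤ |z|}, (wprof δ κ (x + z) - wprof δ κ x) ∂μ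
      ≤ ∫ z, min 1 (κ ^ 2 * z ^ 2) ∂μ := by
  set S := {z : ℝ | ε ≤ |z|} with hS
  have hi : IntegrableOn (fun z => wprof δ κ (x + z) - wprof δ κ x) S μ :=
    trunc_integrable μ hμ ε h0 h1 _ (wprof_cont δ κ) (1 + δ)
      (fun y => abs_le.2 ⟨by linarith [wprof_lower δ κ y], (wprof_upper δ κ y).le⟩) x
  have hmp : MeasurePreserving (fun z : ℝ => -z) μ μ := ⟨measurable_neg, hμ.symm⟩
  have hmp' := hmp.restrict_preimage (trunc_meas ε)
  have hpre : (fun z : ℝ => -z) ⁻¹' {z : ℝ | ε ≤ |z|} = S := by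
    ext z; simp [hS]
  rw [hpre] at hmp'
  have hemb : MeasurableEmbedding (fun z : ℝ => -z) := (MeasurableEquiv.neg ℝ).measurableEmbedding
  have he : ∫ z in S, (wprof δ κ (x + -z) - wprof δ κ x) ∂μ
      = ∫ z in S, (wprof δ κ (x + z) - wprof δ κ x) ∂μ :=
    hmp'.integral_comp hemb (fun z => wprof δ κ (x + z) - wprof δ κ x)
  have hi' : IntegrableOn (fun z => wprof δ κ (x + -z) - wprof δ κ x) S μ :=
    (hmp'.integrable_comp_emb hemb).2 hi
  have hsum : ∫ z in S, ((wprof δ κ (x + z) - wprof δ κ x) + (wprof δ κ (x + -z) - wprof δ κ x)) ∂μ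
      = 2 * ∫ z in S, (wprof δ κ (x + z) - wprof δ κ x) ∂μ := by
    rw [integral_add hi hi', he]; ring
  have hle : ∫ z in S, ((wprof δ κ (x + z) - wprof δ κ x) + (wprof δ κ (x + -z) - wprof δ κ x)) ∂μ
      ≤ ∫ z in S, 2 * min 1 (κ ^ 2 * z ^ 2) ∂μ :=
    integral_mono (hi.add hi') (hI.integrableOn.const_mul 2)
      (fun z => (le_abs_self _).trans (wprof_second δ κ x z))
  have hle2 : ∫ z in S, min 1 (κ ^ 2 * z ^ 2) ∂μ ≤ ∫ z, min 1 (κ ^ 2 * z ^ 2) ∂μ :=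
    setIntegral_le_integral hI (Eventually.of_forall fun z => by
      simp only [Pi.zero_apply]; positivity)
  rw [integral_const_mul] at hle
  linarith

/-- Sliding: existence of a touching point. -/
lemma touching (u w : ℝ → ℝ) (hu : Continuous u) (hw : Continuous w) (δ : ℝ) (hδ : 0 < δ)
    (hδ1 : δ < 1) (hlow : ∀ y, δ < w y) (htop : Tendsto w atTop (𝓝 δ))
    (hbot : Tendsto w atBot (𝓝 (1 + δ)))
    (hu1 : ∀ x, u x ≤ 1) (hub : Tendsto u atBot (𝓝 1)) (hut : Tendsto u atTop (𝓝 0)) :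
    ∃ x τ, u x = w (x - τ) ∧ ∀ y, u y ≤ w (y - τ) := by
  obtain ⟨A, hA⟩ := eventually_atTop.1 (hut.eventually (gt_mem_nhds hδ))
  obtain ⟨y1, hy1⟩ := eventually_atBot.1 (hbot.eventually (lt_mem_nhds (show 1 < 1 + δ by linarith)))
  obtain ⟨x0, hx0⟩ := (hub.eventually (lt_mem_nhds hδ1)).exists
  obtain ⟨y0, hy0⟩ := (htop.eventually (gt_mem_nhds hx0)).exists
  have hxA : ∀ x τ, w (x - τ) ≤ u x → x ≤ A := by
    intro x τ h
    by_contra hc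
    have := hA x (not_le.1 hc).le
    linarith [hlow (x - τ)]
  have hxy : ∀ x τ, w (x - τ) ≤ u x → y1 ≤ x - τ := by
    intro x τ h
    by_contra hc
    have := hy1 (x - τ) (not_le.1 hc).le
    linarith [hu1 x]
  let P : Set (ℝ × ℝ) := {p | w (p.1 - p.2) ≤ u p.1 ∧ x0 - y0 ≤ p.2}
  have hPc : IsClosed P := by
    have c1 : IsClosed {p : ℝ × ℝ | w (p.1 - p.2) ≤ u p.1} :=
      isClosed_le (by fun_prop) (by fun_prop)
    have c2 : IsClosed {p : ℝ × ℝ | x0 - y0 ≤ p.2} :=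
      isClosed_le (by fun_prop) (by fun_prop)
    exact c1.inter c2
  have hPK : IsCompact P := by
    refine IsCompact.of_isClosed_subset
      ((isCompact_Icc (a := y1 + (x0 - y0)) (b := A)).prod
        (isCompact_Icc (a := x0 - y0) (b := A - y1))) hPc ?_
    rintro ⟨x, τ⟩ ⟨h1, h2⟩
    simp only at h1 h2
    have a1 := hxA x τ h1
    have a2 := hxy x τ h1
    refine ⟨⟨?_, ?_⟩, ⟨?_, ?_⟩⟩ <;> simp only <;> linarith
  have hne : P.Nonempty := ⟨(x0, x0 - y0), by
    refine ⟨?_, le_rfl⟩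
    simp only [sub_sub_cancel]
    exact hy0.le⟩
  obtain ⟨⟨x, τ⟩, hp, hmax⟩ := hPK.exists_isMaxOn hne continuous_snd.continuousOn
  have key : ∀ y, u y ≤ w (y - τ) := by
    intro y
    by_contra hc
    push Not at hc
    have hcont : Continuous (fun t => w (y - t)) := by fun_prop
    have hev : ∀ᶠ t in 𝓝[>] τ, w (y - t) < u y :=
      ((hcont.tendsto τ).eventually (gt_mem_nhds hc)).filter_mono nhdsWithin_le_nhds
    obtain ⟨t, ht, htτ⟩ := (hev.and self_mem_nhdsWithin).exists
    have htτ : τ < t := htτ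
    have hmem : (y, t) ∈ P := ⟨ht.le, hp.2.trans htτ.le⟩
    have := hmax hmem
    simp only [mem_ofPred_eq] at this
    linarith
  exact ⟨x, τ, le_antisymm (key x) hp.1, key⟩

/-- Strict supersolution, uniformly in the truncation. -/
lemma supersol (μ : Measure ℝ) (hμ : LevyMeasure μ) (f : ℝ → ℝ) (θ : ℝ) (hf : Bistable f θ) :
    ∃ δ κ C : ℝ, 0 < δ ∧ δ < 1 ∧ 0 < κ ∧ 0 < C ∧ ∀ ε, 0 < ε → ε ≤ 1 → ∀ x,
      (∫ z in {z : ℝ | ε ≤ |z|}, (wprof δ κ (x + z) - wprof δ κ x) ∂μ) + f (wprof δ κ x)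
        < C * (κ / (Real.pi * (1 + (κ * x) ^ 2))) := by
  have hfc : Continuous f := hf.smooth.continuous
  have hθ0 := hf.θ_mem.1
  have hθ1 := hf.θ_mem.2
  obtain ⟨r, hr0, hr⟩ : ∃ r, 0 < r ∧ ∀ s, 1 < s → s < 1 + r → f s < 0 := by
    have hd : HasDerivAt f (deriv f 1) 1 :=
      ((hf.smooth.differentiable (by norm_num)) 1).hasDerivAt
    have h1 := (hasDerivAt_iff_tendsto_slope.1 hd).eventually (gt_mem_nhds hf.df1)
    have h2 : ∀ᶠ s in 𝓝[>] (1:ℝ), slope f 1 s < 0 :=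
      h1.filter_mono (nhdsWithin_mono _ (fun s hs => ne_of_gt hs))
    obtain ⟨b, hb, hb'⟩ := mem_nhdsGT_iff_exists_Ioo_subset.1 h2
    have hb : 1 < b := hb
    refine ⟨b - 1, by linarith, fun s hs hs' => ?_⟩
    have h3 : slope f 1 s < 0 := hb' ⟨hs, by linarith⟩
    rw [slope_def_field, hf.f1, sub_zero] at h3
    by_contra hc
    push Not at hc
    have : 0 ≤ f s / (s - 1) := div_nonneg hc (by linarith)
    linarith
  set δ := min θ r / 3 with hδ
  have hm : 0 < min θ r := lt_min hθ0 hr0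
  have hmθ := min_le_left θ r
  have hmr := min_le_right θ r
  have hδ0 : 0 < δ := by positivity
  have hδθ : 2 * δ < θ := by rw [hδ]; linarith
  have hδr : δ < r := by rw [hδ]; linarith
  have hδ1 : δ < 1 := by linarith
  have hK : IsCompact (Icc δ (2 * δ) ∪ Icc (1 + δ / 2) (1 + δ)) := isCompact_Icc.union isCompact_Icc
  obtain ⟨s0, hs0, hs0max⟩ := hK.exists_isMaxOn
    ⟨δ, Or.inl ⟨le_rfl, by linarith⟩⟩ hfc.continuousOn
  have hneg : f s0 < 0 := by
    rcases hs0 with h | h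
    · exact hf.neg s0 ⟨by linarith [h.1], by linarith [h.2]⟩
    · exact hr s0 (by linarith [h.1]) (by linarith [h.2])
  obtain ⟨s1, hs1, hs1max⟩ := (isCompact_Icc (a := δ) (b := 1 + δ)).exists_isMaxOn
    ⟨δ, le_rfl, by linarith⟩ hfc.continuousOn
  obtain ⟨κ, hκ, hI, hlt⟩ := moment_small μ hμ (-f s0) (by linarith)
  have hpi := Real.pi_pos
  set T := Real.tan (Real.pi / 2 - Real.pi * (δ / 2)) with hT
  have hT2 : Real.arctan T = Real.pi / 2 - Real.pi * (δ / 2) :=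
    Real.arctan_tan (by nlinarith) (by nlinarith)
  set m := κ / (Real.pi * (1 + T ^ 2)) with hmdef
  have hm0 : 0 < m := by positivity
  refine ⟨δ, κ, (|f s1| + -f s0) / m, hδ0, hδ1, hκ, div_pos (by linarith [abs_nonneg (f s1)]) hm0, ?_⟩
  intro ε h0 h1 x
  have hD := wprof_D μ hμ δ κ hδ0 hI ε h0 h1 x
  have hl := wprof_lower δ κ x
  have hu := wprof_upper δ κ x
  have hC0 : 0 < (|f s1| + -f s0) / m := div_pos (by linarith [abs_nonneg (f s1)]) hm0
  by_cases hin : wprof δ κ x ∈ Icc δ (2 * δ) ∪ Icc (1 + δ / 2) (1 + δ)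
  · have h2 : f (wprof δ κ x) ≤ f s0 := hs0max hin
    have h3 : 0 ≤ (|f s1| + -f s0) / m * (κ / (Real.pi * (1 + (κ * x) ^ 2))) := by positivity
    linarith
  · have hA : 2 * δ < wprof δ κ x := by
      by_contra hc; exact hin (Or.inl ⟨hl.le, not_lt.1 hc⟩)
    have hB : wprof δ κ x < 1 + δ / 2 := by
      by_contra hc; exact hin (Or.inr ⟨not_lt.1 hc, hu.le⟩)
    have h2 : f (wprof δ κ x) ≤ f s1 := hs1max ⟨hl.le, hu.le⟩
    have e : Real.arctan (κ * x) = Real.pi * (δ + 1 / 2 - wprof δ κ x) := by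
      unfold wprof; field_simp; ring
    have hup : κ * x < T := by
      rw [← Real.arctan_lt_arctan_iff, hT2, e]; nlinarith
    have hlo : -T < κ * x := by
      rw [← Real.arctan_lt_arctan_iff, Real.arctan_neg, hT2, e]; nlinarith
    have hsq : (κ * x) ^ 2 ≤ T ^ 2 := sq_le_sq' hlo.le hup.le
    have hmle : m ≤ κ / (Real.pi * (1 + (κ * x) ^ 2)) := by
      rw [hmdef]; gcongr
    have h4 := mul_le_mul_of_nonneg_left hmle hC0.le
    rw [div_mul_cancel₀ _ hm0.ne'] at h4
    linarith [le_abs_self (f s1)]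

/-- uniform upper bound on the approximated speeds (Proposition 4.2). -/
theorem approx_speed_upper_bound
    (μ : Measure ℝ) (hμ : LevyMeasure μ) (hinf : μ Set.univ = ⊤)
    (f : ℝ → ℝ) (hf : ∃ θ, Bistable f θ)
    (hint : 0 < ∫ s in (0:ℝ)..1, f s) :
    ∃ ε₀ ∈ Set.Ioc (0 : ℝ) 1, ∃ cbar : ℝ, 0 < cbar ∧
      ∀ ε ∈ Set.Ioc (0 : ℝ) ε₀,
        ∀ (c : ℝ) (u : ℝ → ℝ), 0 < c → ContDiff ℝ 2 u →
          (∃ M : ℝ, ∀ x, |u x| ≤ M) → Antitone u →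
          (∀ x, -c * deriv u x
            = (∫ z in {z : ℝ | ε ≤ |z|}, (u (x + z) - u x) ∂μ) + f (u x)) →
          Tendsto u atBot (𝓝 (1 : ℝ)) → Tendsto u atTop (𝓝 (0 : ℝ)) →
          c ≤ cbar := by
  obtain ⟨θ, hf⟩ := hf
  obtain ⟨δ, κ, C, hδ, hδ1, hκ, hC, hsup⟩ := supersol μ hμ f θ hf
  refine ⟨1, ⟨one_pos, le_rfl⟩, C, hC, ?_⟩
  rintro ε ⟨hε0, hε1⟩ c u hc hu2 ⟨M, hM⟩ hanti heq hbot htop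
  have huc : Continuous u := hu2.continuous
  have hu1 : ∀ x, u x ≤ 1 := fun x => by
    refine ge_of_tendsto hbot ?_
    filter_upwards [eventually_le_atBot x] with y hy using hanti hy
  obtain ⟨x, τ, hxτ, hle⟩ := touching u (wprof δ κ) huc (wprof_cont δ κ) δ hδ hδ1
    (wprof_lower δ κ) (wprof_top δ κ hκ) (wprof_bot δ κ hκ) hu1 hbot htop
  have hdu : HasDerivAt u (deriv u x) x := ((hu2.differentiable (by norm_num)) x).hasDerivAt
  have hdw : HasDerivAt (fun y => wprof δ κ (y - τ))
      (-(κ / (Real.pi * (1 + (κ * (x - τ)) ^ 2)))) x :=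
    (wprof_hasDeriv δ κ (x - τ)).comp_sub_const x τ
  have hmin : IsLocalMin (fun y => wprof δ κ (y - τ) - u y) x :=
    Eventually.of_forall fun y => by
      have := hle y
      simp only
      linarith
  have hd0 := hmin.hasDerivAt_eq_zero (hdw.sub hdu)
  have hint1 := trunc_integrable μ hμ ε hε0 hε1 u huc M hM x
  have hint2 := trunc_integrable μ hμ ε hε0 hε1 (wprof δ κ) (wprof_cont δ κ) (1 + δ)
      (fun y => abs_le.2 ⟨by linarith [wprof_lower δ κ y], (wprof_upper δ κ y).le⟩) (x - τ)
  have hmono : ∫ z in {z : ℝ | ε ≤ |z|}, (u (x + z) - u x) ∂μ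
      ≤ ∫ z in {z : ℝ | ε ≤ |z|}, (wprof δ κ (x - τ + z) - wprof δ κ (x - τ)) ∂μ := by
    refine integral_mono hint1 hint2 (fun z => ?_)
    have := hle (x + z)
    rw [show x + z - τ = x - τ + z by ring] at this
    simp only
    linarith
  have h1 := heq x
  have h2 := hsup ε hε0 hε1 (x - τ)
  rw [hxτ] at h1
  rw [← hxτ] at h2 hmono
  rw [← hxτ] at h1
  have hp : 0 < κ / (Real.pi * (1 + (κ * (x - τ)) ^ 2)) := by
    have := Real.pi_pos
    positivity
  have hdeq : deriv u x = -(κ / (Real.pi * (1 + (κ * (x - τ)) ^ 2))) := by linarith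
  rw [hdeq] at h1
  have h3 : c * (κ / (Real.pi * (1 + (κ * (x - τ)) ^ 2)))
      < C * (κ / (Real.pi * (1 + (κ * (x - τ)) ^ 2))) := by linarith
  exact (lt_of_mul_lt_mul_right h3 hp.le).le
end

section
/- Let μ be a measure as in the context with μ(ℝ) = ∞, let f be of bistable type with threshold θ and ∫₀¹ f(s) ds > 0, and fix ρ ∈ (0, θ). Suppose there are ε₀ ∈ (0,1] and constants 0 < c̲ ≤ c̄ such that for each ε ∈ (0, ε₀] there is a pair (c_ε, u_ε) with c̲ ≤ c_ε ≤ c̄, u_ε ∈ C²(ℝ) bounded, monotone nonincreasing, u_ε(0) = ρ, satisfying −c_ε u_ε'(x) = ∫_{|z| ≥ ε} (u_ε(x+z) − u_ε(x)) dμ(z) + f(u_ε(x)) for every x ∈ ℝ, lim_{x→−∞} u_ε(x) = 1 and lim_{x→+∞} u_ε(x) = 0. Then there exist a sequence ε_n → 0, a real number c > 0, and a monotone nonincreasing function u ∈ C¹(ℝ) with u(0) = ρ, such that c_{ε_n} → c, u_{ε_n} → u in C¹ uniformly on compact subsets of ℝ, for almost every x the principal value D_μ u(x) exists with D_μ u(x)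 + c u'(x) + f(u(x)) = 0, and lim_{x→−∞} u(x) = 1, lim_{x→+∞} u(x) = 0. -/
open MeasureTheory Filter Topology Set

open scoped ENNReal


lemma aux_cs {α : Type*} [MeasurableSpace α] (m : Measure α) (φ ψ : α → ℝ≥0∞)
    (hφ : AEMeasurable φ m) (hψ : AEMeasurable ψ m) :
    (∫⁻ a, φ a * ψ a ∂m) ^ 2 ≤ (∫⁻ a, φ a ^ 2 ∂m) * (∫⁻ a, ψ a ^ 2 ∂m) := by
  have h := ENNReal.lintegral_mul_le_Lp_mul_Lq m (p := 2) (q := 2)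
    Real.HolderConjugate.two_two hφ hψ
  simp only [Pi.mul_apply] at h
  have h2 : ∀ t : ℝ≥0∞, (t ^ (1 / 2 : ℝ)) ^ 2 = t := by
    intro t
    rw [← ENNReal.rpow_natCast, ← ENNReal.rpow_mul]; norm_num
  calc (∫⁻ a, φ a * ψ a ∂m) ^ 2 ≤ _ := pow_le_pow_left' h 2
    _ = _ := by
      rw [mul_pow, h2, h2]; simp

lemma aux_cs1 {α : Type*} [MeasurableSpace α] (m : Measure α) (φ : α → ℝ≥0∞)
    (hφ : AEMeasurable φ m) :
    (∫⁻ a, φ a ∂m) ^ 2 ≤ m univ * (∫⁻ a, φ a ^ 2 ∂m) := by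
  have := aux_cs m (fun _ => 1) φ aemeasurable_const hφ
  simpa using this

lemma aux_transl (w w' : ℝ → ℝ) (hw : ∀ x, HasDerivAt w (w' x) x) (hc : Continuous w') (z : ℝ) :
    ∫⁻ x, ‖w (x + z) - w x‖ₑ ^ 2 ≤ ‖z‖ₑ ^ 2 * ∫⁻ x, ‖w' x‖ₑ ^ 2 := by
  have key : ∀ x, ‖w (x + z) - w x‖ₑ ^ 2 ≤
      ‖z‖ₑ ^ 2 * ∫⁻ t in Ioc (0:ℝ) 1, ‖w' (x + t * z)‖ₑ ^ 2 := by
    intro x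
    have h1 : w (x + z) - w x = ∫ t in (0:ℝ)..1, w' (x + t * z) * z := by
      have := intervalIntegral.integral_eq_sub_of_hasDerivAt (a := (0:ℝ)) (b := 1)
        (f := fun t => w (x + t * z)) (f' := fun t => w' (x + t * z) * z)
        (fun t _ => by
          have h2 : HasDerivAt (fun t : ℝ => x + t * z) z t := by
            simpa using ((hasDerivAt_id t).mul_const z).const_add x
          exact (hw (x + t * z)).comp t h2)
        ((by fun_prop : Continuous fun t => w' (x + t * z) * z).intervalIntegrable _ _)
      rw [this]; simp
    rw [h1, intervalIntegral.integral_of_le zero_le_one]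
    have h3 : ‖∫ t in Ioc (0:ℝ) 1, w' (x + t * z) * z‖ₑ ≤
        ‖z‖ₑ * ∫⁻ t in Ioc (0:ℝ) 1, ‖w' (x + t * z)‖ₑ := by
      refine (enorm_integral_le_lintegral_enorm _).trans ?_
      have hcm := hc.measurable
      rw [← lintegral_const_mul _ (by fun_prop)]
      simp_rw [enorm_mul, mul_comm]; exact le_rfl
    refine (pow_le_pow_left' h3 2).trans ?_
    rw [mul_pow]
    gcongr
    refine (aux_cs1 _ _ (by fun_prop)).trans ?_
    simp
  calc ∫⁻ x, ‖w (x + z) - w x‖ₑ ^ 2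
      ≤ ∫⁻ x, ‖z‖ₑ ^ 2 * ∫⁻ t in Ioc (0:ℝ) 1, ‖w' (x + t * z)‖ₑ ^ 2 := lintegral_mono key
    _ = ‖z‖ₑ ^ 2 * ∫⁻ x, ∫⁻ t in Ioc (0:ℝ) 1, ‖w' (x + t * z)‖ₑ ^ 2 := by
        rw [lintegral_const_mul' _ _ (by simp)]
    _ = ‖z‖ₑ ^ 2 * ∫⁻ t in Ioc (0:ℝ) 1, ∫⁻ x, ‖w' (x + t * z)‖ₑ ^ 2 := by
        rw [lintegral_lintegral_swap]
        have hcm := hc.measurable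
        apply Measurable.aemeasurable
        exact (by fun_prop : Measurable fun p : ℝ × ℝ => ‖w' (p.1 + p.2 * z)‖ₑ ^ 2)
    _ = _ := by
        congr 1
        have : ∀ t : ℝ, ∫⁻ x, ‖w' (x + t * z)‖ₑ ^ 2 = ∫⁻ x, ‖w' x‖ₑ ^ 2 := fun t =>
          lintegral_add_right_eq_self (fun x => ‖w' x‖ₑ ^ 2) (t * z)
        simp [this]

lemma aux_second (u v v' : ℝ → ℝ) (hu : ∀ x, HasDerivAt u (v x) x)
    (hv : ∀ x, HasDerivAt v (v' x) x) (hc : Continuous v') (z : ℝ) :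
    ∫⁻ x, ‖u (x + z) + u (x - z) - 2 * u x‖ₑ ^ 2 ≤ ‖z‖ₑ ^ 4 * ∫⁻ x, ‖v' x‖ₑ ^ 2 := by
  have hvc : Continuous v := continuous_iff_continuousAt.2 fun x => (hv x).continuousAt
  have h1 := aux_transl (fun x => u (x + z) - u x) (fun x => v (x + z) - v x)
    (fun x => ((hu (x + z)).comp_add_const x z).sub (hu x)) (by fun_prop) (-z)
  have h2 := aux_transl v v' hv hc z
  calc _ ≤ ∫⁻ x, ‖(u (x + -z + z) - u (x + -z)) - (u (x + z) - u x)‖ₑ ^ 2 := by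
        apply lintegral_mono; intro x
        apply le_of_eq
        simp only
        rw [← enorm_neg]; congr 2
        rw [neg_add_cancel_right]; ring_nf
    _ ≤ _ := h1
    _ ≤ ‖-z‖ₑ ^ 2 * (‖z‖ₑ ^ 2 * ∫⁻ x, ‖v' x‖ₑ ^ 2) := by gcongr
    _ = _ := by rw [enorm_neg, ← mul_assoc]; ring

lemma aux_mink (m : Measure ℝ) (hm : ∫⁻ z, ‖z‖ₑ ^ 2 ∂m ≠ ⊤) (u : ℝ → ℝ) (hu : Continuous u)
    (K : ℝ≥0∞)
    (hK : ∀ z, ∫⁻ x, ‖u (x + z) + u (x - z) - 2 * u x‖ₑ ^ 2 ≤ ‖z‖ₑ ^ 4 * K) :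
    ∫⁻ x, (∫⁻ z, ‖u (x + z) + u (x - z) - 2 * u x‖ₑ ∂m) ^ 2 ≤ (∫⁻ z, ‖z‖ₑ ^ 2 ∂m) ^ 2 * K := by
  set n := m.withDensity (fun z => ‖z‖ₑ ^ 2) with hn
  have hnu : n univ = ∫⁻ z, ‖z‖ₑ ^ 2 ∂m := by simp [hn]
  have : IsFiniteMeasure n := ⟨by rw [hnu]; exact hm.lt_top⟩
  set φ : ℝ → ℝ → ℝ≥0∞ := fun x z => ‖u (x + z) + u (x - z) - 2 * u x‖ₑ / ‖z‖ₑ ^ 2 with hφ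
  have hmeas : Measurable (fun p : ℝ × ℝ => φ p.1 p.2) := by
    apply Measurable.div
    · have : Continuous fun p : ℝ × ℝ => u (p.1 + p.2) + u (p.1 - p.2) - 2 * u p.1 := by fun_prop
      exact this.measurable.enorm
    · fun_prop
  have hm1 : ∀ x, Measurable (φ x) := fun x => by
    apply Measurable.div
    · have : Continuous fun z : ℝ => u (x + z) + u (x - z) - 2 * u x := by fun_prop
      exact this.measurable.enorm
    · fun_prop
  have e1 : ∀ x, ∫⁻ z, ‖u (x + z) + u (x - z) - 2 * u x‖ₑ ∂m = ∫⁻ z, φ x z ∂n := by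
    intro x
    rw [hn, lintegral_withDensity_eq_lintegral_mul m (f := fun z : ℝ => ‖z‖ₑ ^ 2) (by fun_prop) (hm1 x)]
    apply lintegral_congr
    intro z
    simp only [Pi.mul_apply, hφ]
    by_cases hz : z = 0
    · subst hz; simp; ring
    · rw [ENNReal.mul_div_cancel (by simpa using hz) (by simp)]
  simp_rw [e1]
  calc ∫⁻ x, (∫⁻ z, φ x z ∂n) ^ 2 ≤ ∫⁻ x, n univ * ∫⁻ z, φ x z ^ 2 ∂n :=
        lintegral_mono fun x => aux_cs1 n (φ x)
          (hm1 x).aemeasurable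
    _ = n univ * ∫⁻ x, ∫⁻ z, φ x z ^ 2 ∂n := by
        rw [lintegral_const_mul' _ _ (measure_ne_top n univ)]
    _ = n univ * ∫⁻ z, (∫⁻ x, φ x z ^ 2) ∂n := by
        rw [lintegral_lintegral_swap]
        exact (hmeas.pow_const 2).aemeasurable
    _ ≤ n univ * ∫⁻ z, K ∂n := by
        gcongr with z
        by_cases hz : z = 0
        · subst hz
          have : ∀ x, φ x 0 = 0 := by
            intro x; simp only [hφ]
            rw [show u (x + 0) + u (x - 0) - 2 * u x = 0 by simp; ring]; simp
          simp [this]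
        · have hz4 : ‖z‖ₑ ^ 4 ≠ 0 := by simpa using hz
          have : ∀ x, φ x z ^ 2 = (‖z‖ₑ ^ 4)⁻¹ * ‖u (x + z) + u (x - z) - 2 * u x‖ₑ ^ 2 := by
            intro x
            simp only [hφ, div_eq_mul_inv]
            rw [mul_pow, mul_comm, ENNReal.inv_pow.symm, ← pow_mul]
          simp_rw [this]
          rw [lintegral_const_mul' _ _ (by simpa using hz4)]
          calc _ ≤ (‖z‖ₑ ^ 4)⁻¹ * (‖z‖ₑ ^ 4 * K) := by gcongr; exact hK z
            _ = K := by rw [← mul_assoc, ENNReal.inv_mul_cancel hz4 (by simp), one_mul]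
    _ = _ := by rw [lintegral_const, hnu]; ring

lemma sym_integral {ν : Measure ℝ} (hs : Measure.map (fun z : ℝ => -z) ν = ν) (g : ℝ → ℝ) :
    ∫ z, g (-z) ∂ν = ∫ z, g z ∂ν := by
  conv_rhs => rw [← hs]
  exact (integral_map_equiv (MeasurableEquiv.neg ℝ) g).symm

lemma sym_restrict {ν : Measure ℝ} (hs : Measure.map (fun z : ℝ => -z) ν = ν) (S : Set ℝ)
    (hS : MeasurableSet S) (h : ∀ z, -z ∈ S ↔ z ∈ S) :
    Measure.map (fun z : ℝ => -z) (ν.restrict S) = ν.restrict S := by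
  have h1 := Measure.restrict_map (μ := ν) (f := fun z : ℝ => -z) measurable_neg hS
  have h2 : (fun z : ℝ => -z) ⁻¹' S = S := by ext z; exact h z
  rw [h2, hs] at h1
  exact h1.symm

lemma fin_restrict {μ : Measure ℝ} (hμ : LevyMeasure μ) {δ : ℝ} (hδ : 0 < δ) :
    IsFiniteMeasure (μ.restrict {z : ℝ | δ ≤ |z|}) := by
  constructor
  rw [Measure.restrict_apply_univ]
  have hk : 0 < min 1 (δ ^ 2) := by positivity
  have h1 := mul_meas_ge_le_lintegral (μ := μ) (f := fun z : ℝ => ENNReal.ofReal (min 1 (z ^ 2)))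
    (by fun_prop) (ENNReal.ofReal (min 1 (δ ^ 2)))
  have h2 : {z : ℝ | δ ≤ |z|} ⊆
      {z : ℝ | ENNReal.ofReal (min 1 (δ ^ 2)) ≤ ENNReal.ofReal (min 1 (z ^ 2))} := by
    intro z hz
    simp only [mem_ofPred_eq] at *
    apply ENNReal.ofReal_le_ofReal
    apply min_le_min le_rfl
    rw [← sq_abs z]; gcongr
  refine (measure_mono h2).trans_lt ?_
  by_contra hcon
  rw [not_lt, top_le_iff] at hcon
  rw [hcon, ENNReal.mul_top (by simpa using hδ.ne')] at h1
  exact absurd (h1.trans_lt hμ.moment) (by simp)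

lemma meas_ge (δ : ℝ) : MeasurableSet {z : ℝ | δ ≤ |z|} :=
  measurableSet_le measurable_const (by fun_prop)

lemma sym_ge {μ : Measure ℝ} (hμ : LevyMeasure μ) (δ : ℝ) :
    Measure.map (fun z : ℝ => -z) (μ.restrict {z : ℝ | δ ≤ |z|}) = μ.restrict {z : ℝ | δ ≤ |z|} :=
  sym_restrict hμ.symm _ (meas_ge δ) (by simp)

lemma integrable_bdd {ν : Measure ℝ} [IsFiniteMeasure ν] {g : ℝ → ℝ} (hg : Continuous g) {M : ℝ}
    (hM : ∀ x, |g x| ≤ M) : Integrable g ν :=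
  Integrable.of_bound hg.aestronglyMeasurable M (Eventually.of_forall hM)

lemma sym_half {ν : Measure ℝ} [IsFiniteMeasure ν] (hs : Measure.map (fun z : ℝ => -z) ν = ν)
    {u : ℝ → ℝ} (hu : Continuous u) {M : ℝ} (hM : ∀ x, |u x| ≤ M) (x : ℝ) :
    ∫ z, (u (x + z) - u x) ∂ν = 2⁻¹ * ∫ z, (u (x + z) + u (x - z) - 2 * u x) ∂ν := by
  have h1 := sym_integral hs (fun z => u (x + z) - u x)
  have i1 : Integrable (fun z => u (x + z) - u x) ν :=
    (integrable_bdd (by fun_prop) (fun z => hM (x + z))).sub (integrable_const _)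
  have i2 : Integrable (fun z => u (x + -z) - u x) ν :=
    (integrable_bdd (by fun_prop) (fun z => hM (x + -z))).sub (integrable_const _)
  have h2 : ∫ z, (u (x + z) + u (x - z) - 2 * u x) ∂ν
      = ∫ z, (u (x + z) - u x) ∂ν + ∫ z, (u (x + -z) - u x) ∂ν := by
    rw [← integral_add i1 i2]
    congr 1; ext z; rw [sub_eq_add_neg x z]; ring
  rw [h2, h1]; ring

/-- Antisymmetry of `D_ν` against the derivative. -/
lemma energy_zero {ν : Measure ℝ} [IsFiniteMeasure ν]
    (hs : Measure.map (fun z : ℝ => -z) ν = ν)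
    {w w' : ℝ → ℝ} (hw : ∀ x, HasDerivAt w (w' x) x) (hi : Integrable w') {M : ℝ}
    (hM : ∀ x, |w x| ≤ M) {a b : ℝ} (ha : Tendsto w atBot (𝓝 a)) (hb : Tendsto w atTop (𝓝 b)) :
    ∫ x, (∫ z, (w (x + z) - w x) ∂ν) * w' x = 0 := by
  have hwc : Continuous w := continuous_iff_continuousAt.2 fun x => (hw x).continuousAt
  have hbd : ∀ x z, |w (x + z) - w x| ≤ 2 * M := fun x z => by
    have h1 := abs_le.1 (hM (x + z)); have h2 := abs_le.1 (hM x)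
    rw [abs_le]; constructor <;> linarith
  have hint : Integrable (fun p : ℝ × ℝ => (w (p.1 + p.2) - w p.1) * w' p.1)
      ((volume : Measure ℝ).prod ν) := by
    have h1 : Integrable (fun p : ℝ × ℝ => w' p.1) ((volume : Measure ℝ).prod ν) := by
      have := hi.mul_prod (ν := ν) (integrable_const (1:ℝ))
      simpa using this
    apply h1.bdd_mul (c := 2 * M)
    · exact (by fun_prop : Continuous fun p : ℝ × ℝ => w (p.1 + p.2) - w p.1).aestronglyMeasurable
    · exact Eventually.of_forall fun p => hbd _ _
  have e1 : ∫ x, (∫ z, (w (x + z) - w x) ∂ν) * w' x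
      = ∫ z, (∫ x, (w (x + z) - w x) * w' x) ∂ν := by
    rw [← integral_integral_swap hint]
    congr 1; ext x; rw [integral_mul_const]
  have hh : ∀ z, (∫ x, (w (x + z) - w x) * w' x) + (∫ x, (w (x + -z) - w x) * w' x) = 0 := by
    intro z
    have I1 : ∀ z, Integrable (fun x => w (x + z) * w' x) := fun z =>
      hi.bdd_mul (c := M) (by fun_prop) (Eventually.of_forall fun x => hM _)
    have I2 : Integrable (fun x => w x * w' x) := by simpa using I1 0
    have I3 : Integrable (fun x => w x * w' (x + z)) :=
      (hi.comp_add_right z).bdd_mul (c := M) (by fun_prop) (Eventually.of_forall fun x => hM _)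
    have t1 : ∫ x, w (x + -z) * w' x = ∫ x, w x * w' (x + z) := by
      rw [← integral_add_right_eq_self (fun x => w (x + -z) * w' x) z]
      simp
    have ta : Tendsto (fun x => w (x + z)) atBot (𝓝 a) :=
      ha.comp (tendsto_atBot_add_const_right _ z tendsto_id)
    have tb : Tendsto (fun x => w (x + z)) atTop (𝓝 b) :=
      hb.comp (tendsto_atTop_add_const_right _ z tendsto_id)
    have s1 : ∫ x, (w' (x + z) * w x + w (x + z) * w' x) = b * b - a * a :=
      integral_of_hasDerivAt_of_tendsto (f := fun x => w (x + z) * w x)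
        (fun x => ((hw (x + z)).comp_add_const x z).mul (hw x))
        ((by simpa [mul_comm] using I3 : Integrable fun x => w' (x + z) * w x).add (I1 z))
        (ta.mul ha) (tb.mul hb)
    have s2 : ∫ x, (w' x * w x + w x * w' x) = b * b - a * a :=
      integral_of_hasDerivAt_of_tendsto (f := fun x => w x * w x)
        (fun x => (hw x).mul (hw x))
        ((by simpa [mul_comm] using I2 : Integrable fun x => w' x * w x).add I2)
        (ha.mul ha) (hb.mul hb)
    rw [integral_add (by simpa [mul_comm] using I3) (I1 z)] at s1
    rw [integral_add (by simpa [mul_comm] using I2) I2] at s2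
    simp_rw [sub_mul]
    rw [integral_sub (I1 z) I2, integral_sub (I1 (-z)) I2, t1]
    simp_rw [mul_comm (w' _)] at s1 s2
    linarith
  rw [e1]
  have h1 := sym_integral hs (fun z => ∫ x, (w (x + z) - w x) * w' x)
  have h2 : ∫ z, (∫ x, (w (x + -z) - w x) * w' x) ∂ν
      = - ∫ z, (∫ x, (w (x + z) - w x) * w' x) ∂ν := by
    rw [← integral_neg]; congr 1; ext z; linarith [hh z]
  linarith

lemma integrable_antitone {w w' : ℝ → ℝ} (hw : ∀ x, HasDerivAt w (w' x) x) (hc : Continuous w')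
    (hanti : Antitone w) {a b : ℝ} (ha : Tendsto w atBot (𝓝 a)) (hb : Tendsto w atTop (𝓝 b)) :
    Integrable w' := by
  have hneg : ∀ x, w' x ≤ 0 := fun x => by
    rw [← (hw x).deriv]; exact hanti.deriv_nonpos
  refine integrable_of_intervalIntegral_norm_tendsto (a - b) (l := atTop) (a := fun n : ℝ => -n)
    (b := fun n : ℝ => n) (fun i => hc.integrableOn_Ioc) tendsto_neg_atTop_atBot tendsto_id ?_
  have h1 : ∀ n : ℝ, ∫ x in -n..n, ‖w' x‖ = w (-n) - w n := by
    intro n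
    have : ∀ x, ‖w' x‖ = - w' x := fun x => by rw [Real.norm_eq_abs, abs_of_nonpos (hneg x)]
    simp_rw [this]
    rw [intervalIntegral.integral_neg,
      intervalIntegral.integral_eq_sub_of_hasDerivAt (fun x _ => hw x) (hc.intervalIntegrable _ _)]
    ring
  simp_rw [h1]
  exact (ha.comp tendsto_neg_atTop_atBot).sub hb

lemma integral_comp_f {f : ℝ → ℝ} (hf : Continuous f) {w w' : ℝ → ℝ}
    (hw : ∀ x, HasDerivAt w (w' x) x) (hi : Integrable fun x => f (w x) * w' x)
    {a b : ℝ} (ha : Tendsto w atBot (𝓝 a)) (hb : Tendsto w atTop (𝓝 b)) :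
    ∫ x, f (w x) * w' x = - ∫ s in b..a, f s := by
  have hF : ∀ x, HasDerivAt (fun y => ∫ s in (0:ℝ)..y, f s) (f x) x := fun x =>
    intervalIntegral.integral_hasDerivAt_right (hf.intervalIntegrable _ _)
      (hf.stronglyMeasurableAtFilter _ _) hf.continuousAt
  have h := integral_of_hasDerivAt_of_tendsto (f := fun x => ∫ s in (0:ℝ)..w x, f s)
    (fun x => (hF (w x)).comp x (hw x)) hi
    ((hF a).continuousAt.tendsto.comp ha) ((hF b).continuousAt.tendsto.comp hb)
  rw [h, ← intervalIntegral.integral_interval_sub_left (hf.intervalIntegrable 0 a)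
    (hf.intervalIntegrable 0 b)]
  ring

lemma integrable_D {ν : Measure ℝ} [IsFiniteMeasure ν] {v : ℝ → ℝ} (hvc : Continuous v)
    (hi : Integrable v) : Integrable fun x => ∫ z, (v (x + z) - v x) ∂ν := by
  have h1 : Integrable (fun p : ℝ × ℝ => v p.1) ((volume : Measure ℝ).prod ν) := by
    have := hi.mul_prod (ν := ν) (integrable_const (1:ℝ))
    simpa using this
  have h2 : Integrable (fun p : ℝ × ℝ => v (p.1 + p.2)) ((volume : Measure ℝ).prod ν) := by
    rw [integrable_prod_iff' (by fun_prop)]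
    refine ⟨Eventually.of_forall fun z => hi.comp_add_right z, ?_⟩
    have : ∀ z : ℝ, ∫ x, ‖v (x + z)‖ = ∫ x, ‖v x‖ := fun z =>
      integral_add_right_eq_self (fun x => ‖v x‖) z
    simp only [this]
    exact integrable_const _
  exact (h2.sub h1).integral_prod_left

lemma hasDerivAt_D {ν : Measure ℝ} [IsFiniteMeasure ν] {u v : ℝ → ℝ}
    (hu : ∀ x, HasDerivAt u (v x) x) (hvc : Continuous v) {M N : ℝ} (hM : ∀ x, |u x| ≤ M)
    (hN : ∀ x, |v x| ≤ N) (x : ℝ) :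
    HasDerivAt (fun x => ∫ z, (u (x + z) - u x) ∂ν) (∫ z, (v (x + z) - v x) ∂ν) x := by
  have huc : Continuous u := continuous_iff_continuousAt.2 fun x => (hu x).continuousAt
  refine (hasDerivAt_integral_of_dominated_loc_of_deriv_le (s := univ) (bound := fun _ => 2 * N)
    (F := fun x z => u (x + z) - u x) (F' := fun x z => v (x + z) - v x)
    univ_mem (Eventually.of_forall fun y => by fun_prop) ?_ (by fun_prop) ?_
    (integrable_const _) ?_).2
  · exact (integrable_bdd (by fun_prop) (fun z => hM (x + z))).sub (integrable_const _)
  · refine Eventually.of_forall fun z y _ => ?_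
    have h1 := abs_le.1 (hN (y + z)); have h2 := abs_le.1 (hN y)
    rw [Real.norm_eq_abs, abs_le]; constructor <;> linarith
  · exact Eventually.of_forall fun z y _ => ((hu (y + z)).comp_add_const y z).sub (hu y)

lemma lint_sq {g : ℝ → ℝ} (hi : Integrable fun x => g x ^ 2) :
    ∫⁻ x, ‖g x‖ₑ ^ 2 = ENNReal.ofReal (∫ x, g x ^ 2) := by
  rw [ofReal_integral_eq_lintegral_ofReal hi (Eventually.of_forall fun x => sq_nonneg _)]
  congr 1; ext x
  rw [Real.enorm_eq_ofReal_abs, ← ENNReal.ofReal_pow (abs_nonneg _), sq_abs]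

lemma apriori {ν : Measure ℝ} [IsFiniteMeasure ν] (hs : Measure.map (fun z : ℝ => -z) ν = ν)
    {f : ℝ → ℝ} (hf : ContDiff ℝ 1 f) {c B : ℝ} (hc : 0 < c)
    (hB : ∀ s ∈ Icc (0:ℝ) 1, |deriv f s| ≤ B)
    {u : ℝ → ℝ} (hu2 : ContDiff ℝ 2 u) (hanti : Antitone u) (h01 : ∀ x, u x ∈ Icc (0:ℝ) 1)
    (heq : ∀ x, -c * deriv u x = (∫ z, (u (x + z) - u x) ∂ν) + f (u x))
    (hlb : Tendsto u atBot (𝓝 1)) (hlt : Tendsto u atTop (𝓝 0)) :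
    Continuous (deriv (deriv u)) ∧ (∀ x, HasDerivAt (deriv u) (deriv (deriv u) x) x) ∧
    (∫⁻ x, ‖deriv u x‖ₑ ^ 2 = ENNReal.ofReal ((∫ s in (0:ℝ)..1, f s) / c)) ∧
    (∫⁻ x, ‖deriv (deriv u) x‖ₑ ^ 2 ≤ ENNReal.ofReal (B ^ 2 / c ^ 2 * ((∫ s in (0:ℝ)..1, f s) / c))) ∧
    (∀ x, deriv u x ^ 2 ≤ (∫ s in (0:ℝ)..1, f s) / c + B ^ 2 / c ^ 2 * ((∫ s in (0:ℝ)..1, f s) / c)) ∧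
    (∀ x y, x ≤ y → (deriv u y - deriv u x) ^ 2 ≤
      B ^ 2 / c ^ 2 * ((∫ s in (0:ℝ)..1, f s) / c) * (y - x)) := by
  set v := deriv u with hv
  set v' := deriv v with hv'
  set m := ∫ s in (0:ℝ)..1, f s with hm
  have hu1 : ContDiff ℝ 1 v := by
    have : ContDiff ℝ (1 + 1) u := by norm_num; exact hu2
    exact (contDiff_succ_iff_deriv.1 this).2.2
  have hud : ∀ x, HasDerivAt u (v x) x := fun x =>
    (hu2.differentiable (by norm_num) x).hasDerivAt
  have hvd : ∀ x, HasDerivAt v (v' x) x := fun x =>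
    (hu1.differentiable (by norm_num) x).hasDerivAt
  have hvc : Continuous v := hu1.continuous
  have hv'c : Continuous v' := hu1.continuous_deriv (by norm_num)
  have huc : Continuous u := hu2.continuous
  have hfc : Continuous f := hf.continuous
  have hu1' : ∀ x, |u x| ≤ 1 := fun x => by
    rw [abs_le]; constructor <;> linarith [(h01 x).1, (h01 x).2]
  have hvi : Integrable v := integrable_antitone hud hvc hanti hlb hlt
  -- bounds on f
  obtain ⟨Cf, hCf⟩ : ∃ C, ∀ s ∈ Icc (0:ℝ) 1, ‖f s‖ ≤ C :=
    isCompact_Icc.exists_bound_of_continuousOn hfc.continuousOn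
  have hDb : ∀ {w : ℝ → ℝ} {N : ℝ}, (∀ x, |w x| ≤ N) → ∀ x,
      |∫ z, (w (x + z) - w x) ∂ν| ≤ 2 * N * ν.real univ := by
    intro w N hN x
    have := norm_integral_le_of_norm_le_const (μ := ν) (f := fun z => w (x + z) - w x) (C := 2 * N)
      (Eventually.of_forall fun z => by
        have h1 := abs_le.1 (hN (x + z)); have h2 := abs_le.1 (hN x)
        rw [Real.norm_eq_abs, abs_le]; constructor <;> linarith)
    simpa using this
  obtain ⟨N, hN⟩ : ∃ N, ∀ x, |v x| ≤ N := by
    refine ⟨(2 * 1 * ν.real univ + Cf) / c, fun x => ?_⟩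
    rw [le_div_iff₀ hc]
    have h1 := heq x
    have h2 := hDb hu1' x
    have h3 := hCf _ (h01 x)
    calc |v x| * c = |-c * v x| := by rw [abs_mul, abs_neg, abs_of_pos hc]; ring
      _ ≤ _ := by rw [h1]; exact (abs_add_le _ _).trans (add_le_add h2 h3)
  -- first energy
  have hsq : ∀ {w : ℝ → ℝ} {N : ℝ}, Continuous w → Integrable w → (∀ x, |w x| ≤ N) →
      Integrable fun x => w x ^ 2 := by
    intro w N hwc hwi hwN
    simp_rw [pow_two]
    exact hwi.bdd_mul (c := N) (by fun_prop) (Eventually.of_forall hwN)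
  have iv2 : Integrable fun x => v x ^ 2 := hsq hvc hvi hN
  have ifv : Integrable fun x => f (u x) * v x :=
    hvi.bdd_mul (c := Cf) (by fun_prop) (Eventually.of_forall fun x => hCf _ (h01 x))
  have iDv : Integrable fun x => (∫ z, (u (x + z) - u x) ∂ν) * v x := by
    refine hvi.bdd_mul (c := 2 * 1 * ν.real univ) ?_ (Eventually.of_forall (hDb hu1'))
    have : Continuous fun x => ∫ z, (u (x + z) - u x) ∂ν := continuous_iff_continuousAt.2
      fun x => (hasDerivAt_D hud hvc hu1' hN x).continuousAt
    exact this.aestronglyMeasurable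
  have E1 : c * ∫ x, v x ^ 2 = m := by
    have h1 := energy_zero hs hud hvi hu1' hlb hlt
    have h2 := integral_comp_f hfc hud ifv hlb hlt
    have h3 : ∫ x, -c * v x ^ 2 = ∫ x, ((∫ z, (u (x + z) - u x) ∂ν) * v x + f (u x) * v x) := by
      congr 1; ext x
      rw [← add_mul, ← heq x]; ring
    rw [integral_add iDv ifv, h1, h2, integral_const_mul] at h3
    linarith
  have E1' : ∫ x, v x ^ 2 = m / c := by field_simp; linarith
  -- second energy
  have heq2 : ∀ x, -c * v' x = (∫ z, (v (x + z) - v x) ∂ν) + deriv f (u x) * v x := by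
    intro x
    have h1 : HasDerivAt (fun x => -c * v x) (-c * v' x) x := (hvd x).const_mul (-c)
    have h2 : HasDerivAt (fun x => (∫ z, (u (x + z) - u x) ∂ν) + f (u x))
        ((∫ z, (v (x + z) - v x) ∂ν) + deriv f (u x) * v x) x :=
      (hasDerivAt_D hud hvc hu1' hN x).add
        (((hf.differentiable (by norm_num) (u x)).hasDerivAt).comp x (hud x))
    rw [← (funext heq : (fun x => -c * v x) = _)] at h2
    exact h1.unique h2
  have hdfc : Continuous (deriv f) := hf.continuous_deriv (by norm_num)
  have hdfu : Continuous fun x => deriv f (u x) := hdfc.comp huc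
  have ifpv : Integrable fun x => deriv f (u x) * v x :=
    hvi.bdd_mul (c := B) (by fun_prop) (Eventually.of_forall fun x => hB _ (h01 x))
  have iv' : Integrable v' := by
    have h1 : v' = fun x => (-c)⁻¹ * ((∫ z, (v (x + z) - v x) ∂ν) + deriv f (u x) * v x) := by
      ext x; rw [← heq2 x]; field_simp
    rw [h1]
    exact ((integrable_D hvc hvi).add ifpv).const_mul _
  obtain ⟨N', hN'⟩ : ∃ N, ∀ x, |v' x| ≤ N := by
    refine ⟨(2 * N * ν.real univ + B * N) / c, fun x => ?_⟩
    rw [le_div_iff₀ hc]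
    have h2 := hDb hN x
    have h3 := hB _ (h01 x)
    calc |v' x| * c = |-c * v' x| := by rw [abs_mul, abs_neg, abs_of_pos hc]; ring
      _ ≤ _ := by
        rw [heq2 x]
        refine (abs_add_le _ _).trans (add_le_add h2 ?_)
        rw [abs_mul]
        exact mul_le_mul h3 (hN x) (abs_nonneg _) ((abs_nonneg _).trans h3)
  have iv'2 : Integrable fun x => v' x ^ 2 := hsq hv'c iv' hN'
  have tvb : Tendsto v atBot (𝓝 0) := tendsto_zero_of_hasDerivAt_of_integrableOn_Iic (a := 0)
    (fun x _ => hvd x) iv'.integrableOn hvi.integrableOn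
  have tvt : Tendsto v atTop (𝓝 0) := tendsto_zero_of_hasDerivAt_of_integrableOn_Ioi (a := 0)
    (fun x _ => hvd x) iv'.integrableOn hvi.integrableOn
  have iDv' : Integrable fun x => (∫ z, (v (x + z) - v x) ∂ν) * v' x :=
    iv'.bdd_mul (c := 2 * N * ν.real univ) (integrable_D hvc hvi).aestronglyMeasurable
      (Eventually.of_forall (hDb hN))
  have ifpvv : Integrable fun x => deriv f (u x) * v x * v' x :=
    iv'.bdd_mul (c := B * N) (by fun_prop) (Eventually.of_forall fun x => by
      rw [Real.norm_eq_abs, abs_mul]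
      exact mul_le_mul (hB _ (h01 x)) (hN x) (abs_nonneg _) ((abs_nonneg _).trans (hB _ (h01 x))))
  have E2 : -c * ∫ x, v' x ^ 2 = ∫ x, deriv f (u x) * v x * v' x := by
    have h1 := energy_zero hs hvd iv' hN tvb tvt
    have h3 : ∫ x, -c * v' x ^ 2
        = ∫ x, ((∫ z, (v (x + z) - v x) ∂ν) * v' x + deriv f (u x) * v x * v' x) := by
      congr 1; ext x
      rw [← add_mul, ← heq2 x]; ring
    rw [integral_add iDv' ifpvv, h1, integral_const_mul] at h3
    linarith
  have E2' : ∫ x, v' x ^ 2 ≤ B ^ 2 / c ^ 2 * (m / c) := by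
    have h1 : ∫ x, -(deriv f (u x) * v x * v' x) ≤
        ∫ x, (c / 2 * v' x ^ 2 + B ^ 2 / (2 * c) * v x ^ 2) := by
      apply integral_mono ifpvv.neg ((iv'2.const_mul _).add (iv2.const_mul _))
      intro x
      change -(deriv f (u x) * v x * v' x) ≤ c / 2 * v' x ^ 2 + B ^ 2 / (2 * c) * v x ^ 2
      have hb : deriv f (u x) ^ 2 ≤ B ^ 2 := by
        rw [← sq_abs]; exact pow_le_pow_left₀ (abs_nonneg _) (hB _ (h01 x)) 2
      have h4 : 0 ≤ (c * v' x + deriv f (u x) * v x) ^ 2 := sq_nonneg _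
      have h5 : deriv f (u x) ^ 2 * v x ^ 2 ≤ B ^ 2 * v x ^ 2 :=
        mul_le_mul_of_nonneg_right hb (sq_nonneg _)
      have h6 : c / 2 * v' x ^ 2 + B ^ 2 / (2 * c) * v x ^ 2
        = (c ^ 2 * v' x ^ 2 + B ^ 2 * v x ^ 2) / (2 * c) := by field_simp
      rw [h6, le_div_iff₀ (by positivity)]
      nlinarith
    rw [integral_neg, ← E2, integral_add (iv'2.const_mul _) (iv2.const_mul _), integral_const_mul,
      integral_const_mul, E1'] at h1
    have h2 : c / 2 * ∫ x, v' x ^ 2 ≤ B ^ 2 / (2 * c) * (m / c) := by linarith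
    have h3 : B ^ 2 / c ^ 2 * (m / c) = (2 / c) * (B ^ 2 / (2 * c) * (m / c)) := by
      field_simp
    rw [h3]
    calc ∫ x, v' x ^ 2 = (2 / c) * (c / 2 * ∫ x, v' x ^ 2) := by field_simp
      _ ≤ _ := by gcongr
  refine ⟨hv'c, hvd, ?_, ?_, ?_, ?_⟩
  · rw [lint_sq iv2, E1']
  · rw [lint_sq iv'2]; exact ENNReal.ofReal_le_ofReal E2'
  · intro x
    have ivv : Integrable fun x => 2 * v x * v' x := by
      have := (iv'.bdd_mul (c := N) (f := v) (by fun_prop) (Eventually.of_forall hN)).const_mul 2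
      simpa [mul_assoc] using this
    have h1 := integral_Iic_of_hasDerivAt_of_tendsto (f := fun x => v x ^ 2)
      (f' := fun x => 2 * v x * v' x) (a := x) (m := 0) (by fun_prop)
      (fun y _ => by simpa using (hvd y).fun_pow 2) ivv.integrableOn (by simpa using tvb.pow 2)
    simp only [sub_zero] at h1
    rw [← h1, ← E1']
    calc ∫ y in Iic x, 2 * v y * v' y ≤ ∫ y in Iic x, (v y ^ 2 + v' y ^ 2) := by
          apply integral_mono ivv.integrableOn (iv2.add iv'2).integrableOn
          intro y; change 2 * v y * v' y ≤ v y ^ 2 + v' y ^ 2; nlinarith [sq_nonneg (v y - v' y)]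
      _ ≤ ∫ y, (v y ^ 2 + v' y ^ 2) := by
          apply setIntegral_le_integral (iv2.add iv'2)
          exact Eventually.of_forall fun y => add_nonneg (sq_nonneg (v y)) (sq_nonneg (v' y))
      _ = _ := integral_add iv2 iv'2
      _ ≤ _ := by rw [E1']; linarith
  · intro x y hxy
    have h1 : v y - v x = ∫ t in x..y, v' t :=
      (intervalIntegral.integral_eq_sub_of_hasDerivAt (fun t _ => hvd t)
        (hv'c.intervalIntegrable _ _)).symm
    have h2 := aux_cs1 (volume.restrict (Ioc x y)) (fun t => ‖v' t‖ₑ) (by fun_prop)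
    have h3 : ‖v y - v x‖ₑ ^ 2 ≤ ENNReal.ofReal ((∫ x, v' x ^ 2) * (y - x)) := by
      rw [h1, intervalIntegral.integral_of_le hxy]
      refine (pow_le_pow_left' (enorm_integral_le_lintegral_enorm _) 2).trans (h2.trans ?_)
      rw [Measure.restrict_apply_univ, Real.volume_Ioc, mul_comm, ENNReal.ofReal_mul
        (integral_nonneg fun x => sq_nonneg _), ← lint_sq iv'2]
      gcongr
      exact Measure.restrict_le_self
    rw [Real.enorm_eq_ofReal_abs, ← ENNReal.ofReal_pow (abs_nonneg _), sq_abs,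
      ENNReal.ofReal_le_ofReal_iff (mul_nonneg (integral_nonneg fun x => sq_nonneg _)
        (by linarith))] at h3
    refine h3.trans ?_
    gcongr

lemma extract (v : ℕ → ℝ → ℝ) (c : ℕ → ℝ) {M K cl cu : ℝ} (hM : ∀ n x, |v n x| ≤ M)
    (hK : ∀ n x y, |v n y - v n x| ≤ Real.sqrt (K * |y - x|)) (hc : ∀ n, c n ∈ Icc cl cu) :
    ∃ φ : ℕ → ℕ, StrictMono φ ∧ ∃ V : ℝ → ℝ, ∃ C ∈ Icc cl cu, Continuous V ∧
      Tendsto (fun n => c (φ n)) atTop (𝓝 C) ∧ (∀ x, Tendsto (fun n => v (φ n) x) atTop (𝓝 (V x))) ∧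
      ∀ S : Set ℝ, IsCompact S → TendstoUniformlyOn (fun n => v (φ n)) V atTop S := by
  have hcpt : IsCompact (Set.pi univ (fun o : Option ℚ =>
      (o.elim (Icc cl cu) (fun _ => Icc (-M) M) : Set ℝ))) := by
    apply isCompact_univ_pi
    rintro (_ | q)
    · exact isCompact_Icc
    · exact isCompact_Icc
  obtain ⟨A, hA, φ, hφ, hlim⟩ := hcpt.tendsto_subseq
    (x := fun n o => o.elim (c n) (fun q : ℚ => v n q)) (by
      intro n o _
      rcases o with _ | q
      · exact hc n
      · exact abs_le.1 (hM n q))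
  rw [tendsto_pi_nhds] at hlim
  have hmod : ∀ x : ℝ, Tendsto (fun y => Real.sqrt (K * |y - x|)) (𝓝 x) (𝓝 0) := by
    intro x
    have : Continuous fun y => Real.sqrt (K * |y - x|) := by fun_prop
    simpa using this.tendsto x
  have hpt : ∀ x : ℝ, ∃ L, Tendsto (fun n => v (φ n) x) atTop (𝓝 L) := by
    intro x
    apply cauchySeq_tendsto_of_complete
    rw [Metric.cauchySeq_iff]
    intro e he
    have h1 := (hmod x).eventually (gt_mem_nhds (show (0:ℝ) < e / 3 by positivity))
    obtain ⟨q, hq⟩ : ∃ q : ℚ, Real.sqrt (K * |(q:ℝ) - x|) < e / 3 := by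
      obtain ⟨r, hr, hr2⟩ := Metric.eventually_nhds_iff.1 h1
      obtain ⟨q, hq1, hq2⟩ := exists_rat_btwn (show x - r < x + r by linarith)
      exact ⟨q, hr2 (by rw [Real.dist_eq, abs_lt]; constructor <;> linarith)⟩
    have hcq : CauchySeq (fun n => v (φ n) q) := (hlim (some q)).cauchySeq
    obtain ⟨N, hN⟩ := Metric.cauchySeq_iff.1 hcq (e / 3) (by positivity)
    refine ⟨N, fun m hm n hn => ?_⟩
    have h2 := hN m hm n hn
    have h3 := hK (φ m) x q
    have h4 := hK (φ n) x q
    rw [Real.dist_eq] at *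
    rw [abs_le] at h3 h4
    rw [abs_lt] at *
    constructor <;> linarith
  choose V hV using hpt
  have hVc : Continuous V := by
    rw [continuous_iff_continuousAt]
    intro x
    rw [ContinuousAt, tendsto_iff_dist_tendsto_zero]
    refine squeeze_zero (fun _ => dist_nonneg) (fun y => ?_) (hmod x)
    rw [Real.dist_eq]
    exact le_of_tendsto ((hV y).sub (hV x)).abs (Eventually.of_forall fun n => hK _ x y)
  have heqc : Equicontinuous (fun n => v (φ n)) := fun x =>
    Metric.equicontinuousAt_of_continuity_modulus _ (hmod x) _
      (Eventually.of_forall fun y n => by rw [dist_comm, Real.dist_eq]; exact hK _ x y)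
  refine ⟨φ, hφ, V, A none, hA none (mem_univ _), hVc, hlim none, hV, fun S hS => ?_⟩
  have h1 := (EquicontinuousOn.tendsto_uniformOnFun_iff_pi (F := fun n => v (φ n))
    (𝔖 := {S : Set ℝ | IsCompact S}) (fun K hK => hK)
    (by
      apply eq_univ_of_forall
      intro x
      exact ⟨{x}, isCompact_singleton, rfl⟩)
    (fun K _ => heqc.equicontinuousOn K) atTop V).2 (tendsto_pi_nhds.2 hV)
  rw [UniformOnFun.tendsto_iff_tendstoUniformlyOn] at h1
  exact h1 S hS

lemma unif_prim {v : ℕ → ℝ → ℝ} {V : ℝ → ℝ} {u : ℕ → ℝ → ℝ} {U : ℝ → ℝ}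
    (hv : ∀ n, Continuous (v n)) (hVc : Continuous V)
    (hu : ∀ n x, HasDerivAt (u n) (v n x) x) (hU : ∀ x, HasDerivAt U (V x) x)
    (h0 : ∀ n, u n 0 = U 0)
    (h : ∀ S : Set ℝ, IsCompact S → TendstoUniformlyOn v V atTop S) (S : Set ℝ)
    (hS : IsCompact S) : TendstoUniformlyOn u U atTop S := by
  obtain ⟨R, hR⟩ := hS.isBounded.exists_norm_le
  rw [Metric.tendstoUniformlyOn_iff]
  intro e he
  have h1 := Metric.tendstoUniformlyOn_iff.1 (h (Icc (-|R|) |R|) isCompact_Icc) (e / (|R| + 1))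
    (by positivity)
  filter_upwards [h1] with n hn x hx
  have hxR : |x| ≤ |R| := (hR x hx).trans (le_abs_self R)
  have e1 : U x - u n x = ∫ t in (0:ℝ)..x, (V t - v n t) := by
    rw [intervalIntegral.integral_sub (hVc.intervalIntegrable _ _) ((hv n).intervalIntegrable _ _),
      intervalIntegral.integral_eq_sub_of_hasDerivAt (fun t _ => hU t) (hVc.intervalIntegrable _ _),
      intervalIntegral.integral_eq_sub_of_hasDerivAt (fun t _ => hu n t)
        ((hv n).intervalIntegrable _ _), h0]
    ring
  rw [Real.dist_eq, e1]
  have h2 := intervalIntegral.norm_integral_le_of_norm_le_const (a := (0:ℝ)) (b := x)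
    (f := fun t => V t - v n t) (C := e / (|R| + 1)) (fun t ht => by
      have : t ∈ Icc (-|R|) |R| := by
        rw [uIoc, mem_Ioc] at ht
        rw [abs_le] at hxR
        constructor
        · refine le_of_lt (lt_of_le_of_lt ?_ ht.1)
          exact le_min (by simp) hxR.1
        · exact ht.2.trans (max_le (abs_nonneg _) hxR.2)
      exact (hn t this).le)
  rw [Real.norm_eq_abs, sub_zero] at h2
  refine h2.trans_lt ?_
  rw [div_mul_eq_mul_div, div_lt_iff₀ (by positivity)]
  nlinarith

lemma fatou_sq {g : ℕ → ℝ → ℝ} {G : ℝ → ℝ} {C : ℝ≥0∞} (hg : ∀ n, Continuous (g n))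
    (hlim : ∀ x, Tendsto (fun n => g n x) atTop (𝓝 (G x)))
    (hC : ∀ᶠ n in atTop, ∫⁻ x, ‖g n x‖ₑ ^ 2 ≤ C) : ∫⁻ x, ‖G x‖ₑ ^ 2 ≤ C := by
  have h1 : ∀ x, Tendsto (fun n => ‖g n x‖ₑ ^ 2) atTop (𝓝 (‖G x‖ₑ ^ 2)) := fun x =>
    ENNReal.Tendsto.pow ((continuous_enorm.tendsto _).comp (hlim x))
  calc ∫⁻ x, ‖G x‖ₑ ^ 2 = ∫⁻ x, liminf (fun n => ‖g n x‖ₑ ^ 2) atTop := by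
        congr 1; ext x; exact (h1 x).liminf_eq.symm
    _ ≤ liminf (fun n => ∫⁻ x, ‖g n x‖ₑ ^ 2) atTop :=
        lintegral_liminf_le fun n => ((hg n).measurable.enorm.pow_const 2)
    _ ≤ C := by
        refine liminf_le_of_frequently_le' hC.frequently

lemma cont_D {ν : Measure ℝ} [IsFiniteMeasure ν] {u : ℝ → ℝ} (hu : Continuous u)
    (h01 : ∀ x, u x ∈ Icc (0:ℝ) 1) : Continuous fun x => ∫ z, (u (x + z) - u x) ∂ν := by
  apply continuous_of_dominated (bound := fun _ => 1)
  · intro x; fun_prop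
  · intro x
    refine Eventually.of_forall fun z => ?_
    have h1 := h01 (x + z); have h2 := h01 x
    rw [Real.norm_eq_abs, abs_le]; constructor <;> linarith [h1.1, h1.2, h2.1, h2.2]
  · exact integrable_const _
  · exact Eventually.of_forall fun z => by fun_prop

lemma meas_lt (δ : ℝ) : MeasurableSet {z : ℝ | |z| < δ} :=
  measurableSet_lt (by fun_prop) measurable_const

lemma eta_le {z : ℝ} (hz : |z| ≤ 1) : ‖z‖ₑ ^ 2 = ENNReal.ofReal (min 1 (z ^ 2)) := by
  rw [Real.enorm_eq_ofReal_abs, ← ENNReal.ofReal_pow (abs_nonneg _), sq_abs, min_eq_right]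
  rw [← sq_abs]; exact pow_le_one₀ (abs_nonneg _) hz

lemma eta_tendsto {μ : Measure ℝ} (hμ : LevyMeasure μ) :
    Tendsto (fun δ : ℝ => ∫⁻ z in {z : ℝ | |z| < δ}, ‖z‖ₑ ^ 2 ∂μ) (𝓝[>] 0) (𝓝 0) := by
  have h1 : (fun δ : ℝ => ∫⁻ z in {z : ℝ | |z| < δ}, ‖z‖ₑ ^ 2 ∂μ)
      = fun δ : ℝ => ∫⁻ z, {z : ℝ | |z| < δ}.indicator (fun z => ‖z‖ₑ ^ 2) z ∂μ := by
    ext δ; rw [lintegral_indicator (meas_lt δ)]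
  rw [h1]
  have := tendsto_lintegral_filter_of_dominated_convergence (μ := μ) (l := 𝓝[>] (0:ℝ))
    (F := fun δ z => {z : ℝ | |z| < δ}.indicator (fun z => ‖z‖ₑ ^ 2) z) (f := fun _ => 0)
    (fun z => ENNReal.ofReal (min 1 (z ^ 2)))
    (Eventually.of_forall fun δ => (by fun_prop : Measurable fun z : ℝ => ‖z‖ₑ ^ 2).indicator
      (meas_lt δ)) ?_ hμ.moment.ne ?_
  · simpa using this
  · have h2 : ∀ᶠ δ : ℝ in 𝓝[>] 0, δ < 1 := nhdsWithin_le_nhds (gt_mem_nhds one_pos)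
    filter_upwards [h2] with δ hδ
    refine Eventually.of_forall fun z => ?_
    by_cases hz : |z| < δ
    · rw [indicator_of_mem (by exact hz), eta_le (by linarith)]
    · rw [indicator_of_notMem (by exact hz)]; simp
  · refine Eventually.of_forall fun z => ?_
    by_cases hz : z = 0
    · subst hz
      apply tendsto_const_nhds.congr
      intro δ
      simp [indicator]
    · have h2 : ∀ᶠ δ : ℝ in 𝓝[>] 0, δ < |z| := nhdsWithin_le_nhds (gt_mem_nhds (abs_pos.2 hz))
      apply tendsto_const_nhds.congr'
      filter_upwards [h2] with δ hδ
      rw [indicator_of_notMem (by simpa using hδ.le)]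

lemma eta_fin {μ : Measure ℝ} (hμ : LevyMeasure μ) {δ : ℝ} (hδ : δ ≤ 1) :
    ∫⁻ z in {z : ℝ | |z| < δ}, ‖z‖ₑ ^ 2 ∂μ ≠ ⊤ := by
  refine ne_top_of_le_ne_top hμ.moment.ne ?_
  calc _ ≤ ∫⁻ z in {z : ℝ | |z| < δ}, ENNReal.ofReal (min 1 (z ^ 2)) ∂μ := by
        apply setLIntegral_mono (by fun_prop)
        intro z hz
        rw [eta_le (le_of_lt (lt_of_lt_of_le hz hδ))]
    _ ≤ _ := setLIntegral_le_lintegral _ _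

lemma annulus {μ : Measure ℝ} (hμ : LevyMeasure μ) {u : ℝ → ℝ} (hu : Continuous u)
    (h01 : ∀ x, u x ∈ Icc (0:ℝ) 1) {K : ℝ≥0∞}
    (hK : ∀ z, ∫⁻ x, ‖u (x + z) + u (x - z) - 2 * u x‖ₑ ^ 2 ≤ ‖z‖ₑ ^ 4 * K) {ε δ : ℝ} (hε : 0 < ε)
    (hεδ : ε ≤ δ) (hδ : δ ≤ 1) :
    ∫⁻ x, ‖Dtrunc μ u ε x - Dtrunc μ u δ x‖ₑ ^ 2 ≤
      (∫⁻ z in {z : ℝ | |z| < δ}, ‖z‖ₑ ^ 2 ∂μ) ^ 2 * K := by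
  refine le_trans (lintegral_mono fun x => ?_)
    (aux_mink (μ.restrict {z : ℝ | |z| < δ}) (eta_fin hμ hδ) u hu K hK)
  gcongr
  have hu1 : ∀ x, |u x| ≤ 1 := fun x => by
    rw [abs_le]; constructor <;> linarith [(h01 x).1, (h01 x).2]
  set A : Set ℝ := {z : ℝ | ε ≤ |z|} ∩ {z : ℝ | |z| < δ} with hA
  have hAm : MeasurableSet A := (meas_ge ε).inter (meas_lt δ)
  have hfin := fin_restrict hμ hε
  have hfinA : IsFiniteMeasure (μ.restrict A) :=
    isFiniteMeasure_of_le _ (Measure.restrict_mono inter_subset_left le_rfl)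
  have hfinδ := fin_restrict hμ (hε.trans_le hεδ)
  have hint : ∀ ν : Measure ℝ, IsFiniteMeasure ν → Integrable (fun z => u (x + z) - u x) ν :=
    fun ν hν => (integrable_bdd (by fun_prop) (fun z => hu1 (x + z))).sub (integrable_const _)
  have hsplit : {z : ℝ | ε ≤ |z|} = A ∪ {z : ℝ | δ ≤ |z|} := by
    ext z
    simp only [hA, mem_union, mem_inter_iff, mem_ofPred_eq]
    constructor
    · intro h
      rcases lt_or_ge |z| δ with h' | h'
      · exact Or.inl ⟨h, h'⟩
      · exact Or.inr h'
    · rintro (h | h)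
      · exact h.1
      · exact hεδ.trans h
  have hdisj : Disjoint A {z : ℝ | δ ≤ |z|} := by
    rw [Set.disjoint_left]
    intro z hz hz'
    have h1 : |z| < δ := hz.2
    have h2 : δ ≤ |z| := hz'
    linarith
  have e1 : Dtrunc μ u ε x - Dtrunc μ u δ x = ∫ z in A, (u (x + z) - u x) ∂μ := by
    unfold Dtrunc
    rw [hsplit, setIntegral_union hdisj (meas_ge δ) (hint _ hfinA) (hint _ hfinδ)]
    ring
  have hsA : Measure.map (fun z : ℝ => -z) (μ.restrict A) = μ.restrict A :=
    sym_restrict hμ.symm A hAm (by intro z; simp [hA])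
  rw [e1, sym_half hsA hu hu1 x, enorm_mul]
  have h2 : ‖(2⁻¹ : ℝ)‖ₑ ≤ 1 := by
    rw [Real.enorm_eq_ofReal_abs, ← ENNReal.ofReal_one]
    apply ENNReal.ofReal_le_ofReal
    rw [abs_of_pos (by norm_num)]; norm_num
  calc _ ≤ 1 * ∫⁻ z in A, ‖u (x + z) + u (x - z) - 2 * u x‖ₑ ∂μ :=
        mul_le_mul' h2 (enorm_integral_le_lintegral_enorm _)
    _ ≤ _ := by
        rw [one_mul]
        exact lintegral_mono_set inter_subset_right

lemma pv_exists {μ : Measure ℝ} (hμ : LevyMeasure μ) {u : ℝ → ℝ} (hu : Continuous u)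
    (h01 : ∀ x, u x ∈ Icc (0:ℝ) 1) {x : ℝ}
    (hx : ∫⁻ z in {z : ℝ | |z| < 1}, ‖u (x + z) + u (x - z) - 2 * u x‖ₑ ∂μ < ⊤) :
    ∃ L, HasPV μ u x L := by
  have hu1 : ∀ x, |u x| ≤ 1 := fun x => by
    rw [abs_le]; constructor <;> linarith [(h01 x).1, (h01 x).2]
  have hc : Continuous fun z => u (x + z) + u (x - z) - 2 * u x := by fun_prop
  have hi : Integrable (fun z => u (x + z) + u (x - z) - 2 * u x) μ := by
    rw [← integrableOn_univ]
    have : (univ : Set ℝ) = {z : ℝ | |z| < 1} ∪ {z : ℝ | 1 ≤ |z|} := by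
      ext z; simp [lt_or_ge]
    rw [this]
    apply IntegrableOn.union
    · exact ⟨hc.aestronglyMeasurable, hx⟩
    · have := fin_restrict hμ one_pos
      apply integrable_bdd (M := 4) hc
      intro z
      have h1 := h01 (x + z); have h2 := h01 x; have h3 := h01 (x - z)
      rw [abs_le]; constructor <;> linarith [h1.1, h1.2, h2.1, h2.2, h3.1, h3.2]
  refine ⟨2⁻¹ * ∫ z, (u (x + z) + u (x - z) - 2 * u x) ∂μ, ?_⟩
  unfold HasPV
  have h1 : Tendsto (fun δ : ℝ => ∫ z, {z : ℝ | δ ≤ |z|}.indicator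
      (fun z => u (x + z) + u (x - z) - 2 * u x) z ∂μ) (𝓝[>] 0)
      (𝓝 (∫ z, (u (x + z) + u (x - z) - 2 * u x) ∂μ)) := by
    apply tendsto_integral_filter_of_dominated_convergence
      (fun z => ‖u (x + z) + u (x - z) - 2 * u x‖)
    · exact Eventually.of_forall fun δ => hc.aestronglyMeasurable.indicator (meas_ge δ)
    · exact Eventually.of_forall fun δ => Eventually.of_forall fun z =>
        norm_indicator_le_norm_self _ _
    · exact hi.norm
    · refine Eventually.of_forall fun z => ?_
      by_cases hz : z = 0
      · subst hz
        have : u (x + 0) + u (x - 0) - 2 * u x = 0 := by simp; ring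
        apply tendsto_const_nhds.congr
        intro δ
        rw [this]
        by_cases h0 : (0:ℝ) ∈ {z : ℝ | δ ≤ |z|}
        · rw [indicator_of_mem h0, this]
        · rw [indicator_of_notMem h0]
      · have h2 : ∀ᶠ δ : ℝ in 𝓝[>] 0, δ < |z| := nhdsWithin_le_nhds (gt_mem_nhds (abs_pos.2 hz))
        apply tendsto_const_nhds.congr'
        filter_upwards [h2] with δ hδ
        rw [indicator_of_mem (by exact hδ.le)]
  apply (h1.const_mul 2⁻¹).congr'
  filter_upwards [self_mem_nhdsWithin] with δ hδ
  have := fin_restrict hμ hδ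
  rw [integral_indicator (meas_ge δ), Dtrunc, sym_half (sym_ge hμ δ) hu hu1 x]

lemma D_tendsto {ι : Type*} {l : Filter ι} [l.IsCountablyGenerated] {ν : Measure ℝ}
    [IsFiniteMeasure ν] {g : ι → ℝ → ℝ} {G : ℝ → ℝ} (hg : ∀ n, Continuous (g n))
    (hb : ∀ n x, |g n x| ≤ 1)
    (h : ∀ z, Tendsto (fun n => g n z) l (𝓝 (G z))) :
    Tendsto (fun n => ∫ z, g n z ∂ν) l (𝓝 (∫ z, G z ∂ν)) :=
  tendsto_integral_filter_of_dominated_convergence (fun _ => 1)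
    (Eventually.of_forall fun n => (hg n).aestronglyMeasurable)
    (Eventually.of_forall fun n => Eventually.of_forall fun z => hb n z)
    (integrable_const _) (Eventually.of_forall h)

lemma diff_bdd {u : ℝ → ℝ} (h01 : ∀ x, u x ∈ Icc (0:ℝ) 1) (x z : ℝ) : |u (x + z) - u x| ≤ 1 := by
  have h1 := h01 (x + z); have h2 := h01 x
  rw [abs_le]; constructor <;> linarith [h1.1, h1.2, h2.1, h2.2]

lemma lim_bound {μ : Measure ℝ} (hμ : LevyMeasure μ) {f : ℝ → ℝ} (hf : Continuous f)
    {cn εn : ℕ → ℝ} {un vn : ℕ → ℝ → ℝ} {c : ℝ} {u v : ℝ → ℝ} {K : ℝ≥0∞}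
    (hεp : ∀ n, 0 < εn n) (hε : Tendsto εn atTop (𝓝 0)) (hc : Tendsto cn atTop (𝓝 c))
    (huc : ∀ n, Continuous (un n)) (h01 : ∀ n x, un n x ∈ Icc (0:ℝ) 1)
    (heq : ∀ n x, -(cn n) * vn n x = Dtrunc μ (un n) (εn n) x + f (un n x))
    (hK : ∀ n z, ∫⁻ x, ‖un n (x + z) + un n (x - z) - 2 * un n x‖ₑ ^ 2 ≤ ‖z‖ₑ ^ 4 * K)
    (hu : ∀ x, Tendsto (fun n => un n x) atTop (𝓝 (u x)))
    (hv : ∀ x, Tendsto (fun n => vn n x) atTop (𝓝 (v x))) {δ : ℝ} (hδ : 0 < δ) (hδ1 : δ ≤ 1) :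
    ∫⁻ x, ‖-c * v x - f (u x) - Dtrunc μ u δ x‖ₑ ^ 2 ≤
      (∫⁻ z in {z : ℝ | |z| < δ}, ‖z‖ₑ ^ 2 ∂μ) ^ 2 * K := by
  have hfin : ∀ {δ : ℝ}, 0 < δ → IsFiniteMeasure (μ.restrict {z : ℝ | δ ≤ |z|}) :=
    fun h => fin_restrict hμ h
  apply fatou_sq (g := fun n x => Dtrunc μ (un n) (εn n) x - Dtrunc μ (un n) δ x)
  · intro n
    have := hfin (hεp n)
    have := hfin hδ
    exact (cont_D (huc n) (h01 n)).sub (cont_D (huc n) (h01 n))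
  · intro x
    have h1 : ∀ n, Dtrunc μ (un n) (εn n) x - Dtrunc μ (un n) δ x
        = -(cn n) * vn n x - f (un n x) - Dtrunc μ (un n) δ x := fun n => by
      rw [heq]; ring
    simp_rw [h1]
    have := hfin hδ
    refine ((hc.neg.mul (hv x)).sub ((hf.tendsto _).comp (hu x))).sub ?_
    exact D_tendsto (fun n => by have := huc n; fun_prop) (fun n z => diff_bdd (h01 n) x z)
      (fun z => (hu (x + z)).sub (hu x))
  · filter_upwards [hε.eventually (gt_mem_nhds hδ)] with n hn
    exact annulus hμ (huc n) (h01 n) (hK n) (hεp n) hn.le hδ1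

lemma lim_ae {μ : Measure ℝ} (hμ : LevyMeasure μ) {f : ℝ → ℝ} (hf : Continuous f)
    {c : ℝ} {u v : ℝ → ℝ} {K : ℝ≥0∞} (hKt : K ≠ ⊤) (huc : Continuous u) (hvc : Continuous v)
    (h01 : ∀ x, u x ∈ Icc (0:ℝ) 1)
    (hK : ∀ z, ∫⁻ x, ‖u (x + z) + u (x - z) - 2 * u x‖ₑ ^ 2 ≤ ‖z‖ₑ ^ 4 * K)
    (hb : ∀ δ : ℝ, 0 < δ → δ ≤ 1 → ∫⁻ x, ‖-c * v x - f (u x) - Dtrunc μ u δ x‖ₑ ^ 2 ≤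
      (∫⁻ z in {z : ℝ | |z| < δ}, ‖z‖ₑ ^ 2 ∂μ) ^ 2 * K) :
    ∀ᵐ x ∂(volume : Measure ℝ), ∃ L : ℝ, HasPV μ u x L ∧ L + c * v x + f (u x) = 0 := by
  have hPV : ∀ᵐ x ∂(volume : Measure ℝ), ∃ L : ℝ, HasPV μ u x L := by
    have h1 := aux_mink (μ.restrict {z : ℝ | |z| < 1}) (eta_fin hμ le_rfl) u huc K hK
    have h2 : ∫⁻ x, (∫⁻ z in {z : ℝ | |z| < 1}, ‖u (x + z) + u (x - z) - 2 * u x‖ₑ ∂μ) ^ 2 ≠ ⊤ :=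
      ne_top_of_le_ne_top (ENNReal.mul_ne_top (ENNReal.pow_ne_top (eta_fin hμ le_rfl)) hKt) h1
    have h3 := ae_lt_top' ?_ h2
    · filter_upwards [h3] with x hx
      apply pv_exists hμ huc h01
      by_contra hcon
      rw [not_lt, top_le_iff] at hcon
      rw [hcon] at hx
      simp at hx
    · apply AEMeasurable.pow_const
      apply Measurable.aemeasurable
      -- lower semicontinuity (Fatou) gives measurability without sigma-finiteness
      apply LowerSemicontinuous.measurable
      rw [lowerSemicontinuous_iff_le_liminf]
      intro x
      have h4 : ∀ z, ‖u (x + z) + u (x - z) - 2 * u x‖ₑ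
          = liminf (fun y => ‖u (y + z) + u (y - z) - 2 * u y‖ₑ) (𝓝 x) := fun z => by
        have : Continuous fun y => ‖u (y + z) + u (y - z) - 2 * u y‖ₑ := by
          apply continuous_enorm.comp; fun_prop
        exact (this.tendsto x).liminf_eq.symm
      simp_rw [h4]
      apply lintegral_liminf_le
      intro y
      exact (by fun_prop : Continuous fun z => u (y + z) + u (y - z) - 2 * u y).measurable.enorm
  set δ : ℕ → ℝ := fun n => 1 / ((n : ℝ) + 1) with hδ
  have hδ0 : ∀ n, 0 < δ n := fun n => by simp only [hδ]; positivity
  have hδ1 : ∀ n, δ n ≤ 1 := fun n => by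
    simp only [hδ]; rw [div_le_one (by positivity)]; linarith [(Nat.cast_nonneg n : (0:ℝ) ≤ n)]
  have hδt : Tendsto δ atTop (𝓝[>] 0) := by
    rw [tendsto_nhdsWithin_iff]
    exact ⟨tendsto_one_div_add_atTop_nhds_zero_nat, Eventually.of_forall hδ0⟩
  have hzero : Tendsto (fun n => (∫⁻ z in {z : ℝ | |z| < δ n}, ‖z‖ₑ ^ 2 ∂μ) ^ 2 * K)
      atTop (𝓝 0) := by
    have h1 := (eta_tendsto hμ).comp hδt
    have h2 := ENNReal.Tendsto.mul_const (b := K) (ENNReal.Tendsto.pow (n := 2) h1) (Or.inr hKt)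
    simpa using h2
  set g : ℕ → ℝ → ℝ := fun n x => -c * v x - f (u x) - Dtrunc μ u (δ n) x with hg
  have hgc : ∀ n, Continuous (g n) := fun n => by
    have := fin_restrict hμ (hδ0 n)
    have h1 : Continuous fun x => Dtrunc μ u (δ n) x := cont_D huc h01
    simp only [hg]; fun_prop
  have hlim0 : ∫⁻ x, liminf (fun n => ‖g n x‖ₑ ^ 2) atTop = 0 := by
    rw [← nonpos_iff_eq_zero]
    refine (lintegral_liminf_le fun n => ((hgc n).measurable.enorm.pow_const 2)).trans ?_
    rw [← hzero.liminf_eq]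
    exact liminf_le_liminf (Eventually.of_forall fun n => hb _ (hδ0 n) (hδ1 n))
  rw [lintegral_eq_zero_iff (Measurable.liminf fun n => (hgc n).measurable.enorm.pow_const 2)]
    at hlim0
  filter_upwards [hPV, hlim0] with x ⟨L, hL⟩ hx
  refine ⟨L, hL, ?_⟩
  have h1 : Tendsto (fun n => g n x) atTop (𝓝 (-c * v x - f (u x) - L)) :=
    tendsto_const_nhds.sub (Tendsto.comp hL hδt)
  have h2 : Tendsto (fun n => ‖g n x‖ₑ ^ 2) atTop (𝓝 (‖-c * v x - f (u x) - L‖ₑ ^ 2)) :=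
    ENNReal.Tendsto.pow ((continuous_enorm.tendsto _).comp h1)
  rw [h2.liminf_eq] at hx
  have h3 : -c * v x - f (u x) - L = 0 := by simpa using hx
  linarith

lemma sq_end {H : ℝ → ℝ} {l : Filter ℝ} (hc : Continuous H) (hH : ∫⁻ x, ‖H x‖ₑ ^ 2 ≠ ⊤)
    (hl : ∀ S ∈ l, volume S = ⊤) {a : ℝ} (ha : Tendsto H l (𝓝 a)) : a = 0 := by
  by_contra hne
  have hp : 0 < |a| := abs_pos.2 hne
  have h1 : ∀ᶠ x in l, |a| / 2 < |H x| := ha.abs.eventually (lt_mem_nhds (by linarith))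
  have h2 : {x | ENNReal.ofReal (|a| / 2) ^ 2 ≤ ‖H x‖ₑ ^ 2} ∈ l := by
    filter_upwards [h1] with x hx
    rw [Real.enorm_eq_ofReal_abs]
    gcongr
  have h3 := mul_meas_ge_le_lintegral (μ := volume) (f := fun x => ‖H x‖ₑ ^ 2)
    (hc.measurable.enorm.pow_const 2) (ENNReal.ofReal (|a| / 2) ^ 2)
  rw [hl _ h2, ENNReal.mul_top] at h3
  · exact hH (top_le_iff.1 h3)
  · simp [hne]

lemma vol_atTop : ∀ S ∈ (atTop : Filter ℝ), volume S = ⊤ := fun S hS => by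
  obtain ⟨N, hN⟩ := mem_atTop_sets.1 hS
  have : Ici N ⊆ S := hN
  exact top_le_iff.1 ((Real.volume_Ici (a := N)) ▸ measure_mono this)

lemma vol_atBot : ∀ S ∈ (atBot : Filter ℝ), volume S = ⊤ := fun S hS => by
  obtain ⟨N, hN⟩ := mem_atBot_sets.1 hS
  have : Iic N ⊆ S := hN
  exact top_le_iff.1 ((Real.volume_Iic (a := N)) ▸ measure_mono this)

lemma end_zero {μ : Measure ℝ} (hμ : LevyMeasure μ) {f : ℝ → ℝ} (hf : Continuous f)
    {c : ℝ} {u v : ℝ → ℝ} {C K₁ : ℝ≥0∞} (hCt : C ≠ ⊤) (hK₁ : K₁ ≠ ⊤)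
    (huc : Continuous u) (hvc : Continuous v)
    (h01 : ∀ x, u x ∈ Icc (0:ℝ) 1) (hv : ∫⁻ x, ‖v x‖ₑ ^ 2 ≤ K₁)
    (hb : ∫⁻ x, ‖-c * v x - f (u x) - Dtrunc μ u 1 x‖ₑ ^ 2 ≤ C)
    {l : Filter ℝ} [l.IsCountablyGenerated] (hl : ∀ S ∈ l, volume S = ⊤)
    (hadd : ∀ z : ℝ, Tendsto (fun x => x + z) l l)
    {a : ℝ} (ha : Tendsto u l (𝓝 a)) : f a = 0 := by
  have := fin_restrict hμ one_pos
  have hDc : Continuous fun x => Dtrunc μ u 1 x := cont_D huc h01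
  have hDt : Tendsto (fun x => Dtrunc μ u 1 x) l (𝓝 0) := by
    have h := D_tendsto (ν := μ.restrict {z : ℝ | 1 ≤ |z|}) (l := l)
      (g := fun x z => u (x + z) - u x) (G := fun _ => 0)
      (fun x => by fun_prop) (fun x z => diff_bdd h01 x z)
      (fun z => by simpa using (ha.comp (hadd z)).sub ha)
    rw [integral_zero] at h
    exact h
  have hlim : Tendsto (fun x => f (u x) + Dtrunc μ u 1 x) l (𝓝 (f a)) := by
    simpa using ((hf.tendsto a).comp ha).add hDt
  refine sq_end (by fun_prop) ?_ hl hlim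
  have hpt : ∀ x, ‖f (u x) + Dtrunc μ u 1 x‖ₑ ^ 2 ≤
      2 * ‖-c * v x - f (u x) - Dtrunc μ u 1 x‖ₑ ^ 2 + 2 * (‖c‖ₑ ^ 2 * ‖v x‖ₑ ^ 2) := by
    intro x
    have h2 : ∀ y : ℝ, ‖y‖ₑ ^ 2 = ENNReal.ofReal (y ^ 2) := fun y => by
      rw [Real.enorm_eq_ofReal_abs, ← ENNReal.ofReal_pow (abs_nonneg _), sq_abs]
    have h3 : (2 : ℝ≥0∞) = ENNReal.ofReal 2 := by simp
    rw [h2, h2, h2, h2, h3, ← ENNReal.ofReal_mul (by positivity),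
      ← ENNReal.ofReal_mul (by positivity), ← ENNReal.ofReal_mul (by positivity),
      ← ENNReal.ofReal_add (by positivity) (by positivity)]
    apply ENNReal.ofReal_le_ofReal
    nlinarith [sq_nonneg ((-c * v x - f (u x) - Dtrunc μ u 1 x) - c * v x)]
  refine ne_top_of_le_ne_top ?_ ((lintegral_mono hpt))
  rw [lintegral_add_right _ (by
      exact ((hvc.measurable.enorm.pow_const 2).const_mul _).const_mul _),
    lintegral_const_mul' _ _ (by simp), lintegral_const_mul' _ _ (by simp),
    lintegral_const_mul' _ _ (by simp)]
  have h4 := ne_top_of_le_ne_top hCt hb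
  have h5 := ne_top_of_le_ne_top hK₁ hv
  finiteness

lemma lim_energy {μ : Measure ℝ} (hμ : LevyMeasure μ) {f : ℝ → ℝ} (hf : Continuous f)
    {c : ℝ} {u v : ℝ → ℝ} {K K₁ : ℝ≥0∞} (hKt : K ≠ ⊤) (hK₁ : K₁ ≠ ⊤)
    (hu : ∀ x, HasDerivAt u (v x) x) (hvc : Continuous v) (hanti : Antitone u)
    (h01 : ∀ x, u x ∈ Icc (0:ℝ) 1) (hv : ∫⁻ x, ‖v x‖ₑ ^ 2 ≤ K₁)
    (hb : ∀ δ : ℝ, 0 < δ → δ ≤ 1 → ∫⁻ x, ‖-c * v x - f (u x) - Dtrunc μ u δ x‖ₑ ^ 2 ≤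
      (∫⁻ z in {z : ℝ | |z| < δ}, ‖z‖ₑ ^ 2 ∂μ) ^ 2 * K)
    {a b : ℝ} (ha : Tendsto u atBot (𝓝 a)) (hbt : Tendsto u atTop (𝓝 b)) :
    ∫ s in b..a, f s = c * ∫ x, v x ^ 2 := by
  have huc : Continuous u := continuous_iff_continuousAt.2 fun x => (hu x).continuousAt
  have hvi := integrable_antitone hu hvc hanti ha hbt
  have hv2 : Integrable fun x => v x ^ 2 := by
    refine ⟨by fun_prop, ?_⟩
    rw [hasFiniteIntegral_iff_enorm]
    simp only [enorm_pow]
    exact lt_of_le_of_lt hv hK₁.lt_top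
  obtain ⟨Bf, hBf⟩ := isCompact_Icc.exists_bound_of_continuousOn (s := Icc (0:ℝ) 1) hf.continuousOn
  have hfi : Integrable fun x => f (u x) * v x :=
    hvi.bdd_mul (c := Bf) (by fun_prop) (Eventually.of_forall fun x => hBf _ (h01 x))
  have hfe := integral_comp_f hf hu hfi ha hbt
  have key : ∀ δ : ℝ, 0 < δ → δ ≤ 1 → ‖(∫ s in b..a, f s) - c * ∫ x, v x ^ 2‖ₑ ^ 2 ≤
      (∫⁻ z in {z : ℝ | |z| < δ}, ‖z‖ₑ ^ 2 ∂μ) ^ 2 * K * K₁ := by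
    intro δ h0 h1
    have hfm := fin_restrict hμ h0
    have hDc : Continuous fun x => Dtrunc μ u δ x := cont_D huc h01
    have hen : ∫ x, Dtrunc μ u δ x * v x = 0 := energy_zero (sym_ge hμ δ) hu hvi (M := 1)
      (fun x => by rw [abs_le]; constructor <;> linarith [(h01 x).1, (h01 x).2]) ha hbt
    have hDi : Integrable fun x => Dtrunc μ u δ x * v x := by
      refine hvi.bdd_mul (c := (μ.restrict {z : ℝ | δ ≤ |z|}).real univ) (by fun_prop)
        (Eventually.of_forall fun x => ?_)
      have := norm_integral_le_of_norm_le_const (μ := μ.restrict {z : ℝ | δ ≤ |z|})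
        (f := fun z => u (x + z) - u x) (C := 1)
        (Eventually.of_forall fun z => diff_bdd h01 x z)
      rw [one_mul] at this
      exact this
    have hid : ∫ x, (-c * v x - f (u x) - Dtrunc μ u δ x) * v x
        = (∫ s in b..a, f s) - c * ∫ x, v x ^ 2 := by
      have h2 : ∀ x, (-c * v x - f (u x) - Dtrunc μ u δ x) * v x
          = -c * v x ^ 2 - f (u x) * v x - Dtrunc μ u δ x * v x := fun x => by ring
      simp_rw [h2]
      have hsub : Integrable fun x => -c * v x ^ 2 - f (u x) * v x := (hv2.const_mul _).sub hfi
      rw [integral_sub hsub hDi, integral_sub (hv2.const_mul _) hfi,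
        integral_const_mul, hfe, hen]
      ring
    rw [← hid]
    calc _ ≤ (∫⁻ x, ‖(-c * v x - f (u x) - Dtrunc μ u δ x) * v x‖ₑ) ^ 2 := by
          gcongr; exact enorm_integral_le_lintegral_enorm _
      _ = (∫⁻ x, ‖-c * v x - f (u x) - Dtrunc μ u δ x‖ₑ * ‖v x‖ₑ) ^ 2 := by
          simp only [enorm_mul]
      _ ≤ _ := by
          refine (aux_cs volume _ _ ?_ ?_).trans (mul_le_mul' (hb δ h0 h1) hv)
          · exact (by fun_prop : Continuous fun x => -c * v x - f (u x) - Dtrunc μ u δ x).measurable.enorm.aemeasurable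
          · exact hvc.measurable.enorm.aemeasurable
  have hlim : Tendsto (fun δ : ℝ => (∫⁻ z in {z : ℝ | |z| < δ}, ‖z‖ₑ ^ 2 ∂μ) ^ 2 * K * K₁)
      (𝓝[>] 0) (𝓝 0) := by
    have h2 := ENNReal.Tendsto.mul_const (b := K₁) (ENNReal.Tendsto.mul_const (b := K)
      (ENNReal.Tendsto.pow (n := 2) (eta_tendsto hμ)) (Or.inr hKt)) (Or.inr hK₁)
    simpa using h2
  have h0 : ‖(∫ s in b..a, f s) - c * ∫ x, v x ^ 2‖ₑ ^ 2 ≤ 0 := by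
    refine ge_of_tendsto hlim ?_
    filter_upwards [Ioc_mem_nhdsGT one_pos] with δ hδ
    exact key δ hδ.1 hδ.2
  have h3 : (∫ s in b..a, f s) - c * ∫ x, v x ^ 2 = 0 := by simpa using h0
  linarith

lemma lim_ends {μ : Measure ℝ} (hμ : LevyMeasure μ) {f : ℝ → ℝ} {θ : ℝ} (hf : Bistable f θ)
    {c ρ : ℝ} (hc : 0 < c) (hρ : ρ ∈ Ioo 0 θ)
    {u v : ℝ → ℝ} {K K₁ : ℝ≥0∞} (hKt : K ≠ ⊤) (hK₁ : K₁ ≠ ⊤)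
    (hu : ∀ x, HasDerivAt u (v x) x) (hvc : Continuous v) (hanti : Antitone u)
    (h01 : ∀ x, u x ∈ Icc (0:ℝ) 1) (hu0 : u 0 = ρ) (hv : ∫⁻ x, ‖v x‖ₑ ^ 2 ≤ K₁)
    (hb : ∀ δ : ℝ, 0 < δ → δ ≤ 1 → ∫⁻ x, ‖-c * v x - f (u x) - Dtrunc μ u δ x‖ₑ ^ 2 ≤
      (∫⁻ z in {z : ℝ | |z| < δ}, ‖z‖ₑ ^ 2 ∂μ) ^ 2 * K) :
    Tendsto u atBot (𝓝 1) ∧ Tendsto u atTop (𝓝 0) := by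
  have huc : Continuous u := continuous_iff_continuousAt.2 fun x => (hu x).continuousAt
  have hfc : Continuous f := hf.smooth.continuous
  obtain ⟨a, ha⟩ : ∃ a, Tendsto u atBot (𝓝 a) :=
    ⟨_, tendsto_atBot_ciSup hanti ⟨1, by rintro _ ⟨x, rfl⟩; exact (h01 x).2⟩⟩
  obtain ⟨b, hbt⟩ : ∃ b, Tendsto u atTop (𝓝 b) :=
    ⟨_, tendsto_atTop_ciInf hanti ⟨0, by rintro _ ⟨x, rfl⟩; exact (h01 x).1⟩⟩
  have ha1 : a ≤ 1 := le_of_tendsto' ha fun x => (h01 x).2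
  have hb0 : 0 ≤ b := ge_of_tendsto' hbt fun x => (h01 x).1
  have haρ : ρ ≤ a := hu0 ▸ hanti.ge_of_tendsto ha 0
  have hbρ : b ≤ ρ := hu0 ▸ hanti.le_of_tendsto hbt 0
  have hC : (∫⁻ z in {z : ℝ | |z| < 1}, ‖z‖ₑ ^ 2 ∂μ) ^ 2 * K ≠ ⊤ :=
    ENNReal.mul_ne_top (ENNReal.pow_ne_top (eta_fin hμ le_rfl)) hKt
  have hfa : f a = 0 := end_zero hμ hfc hC hK₁ huc hvc h01 hv (hb 1 one_pos le_rfl) vol_atBot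
    (fun z => tendsto_atBot_add_const_right _ z tendsto_id) ha
  have hfb : f b = 0 := end_zero hμ hfc hC hK₁ huc hvc h01 hv (hb 1 one_pos le_rfl) vol_atTop
    (fun z => tendsto_atTop_add_const_right _ z tendsto_id) hbt
  have hbz : b = 0 := by
    by_contra hne
    have := hf.neg b ⟨lt_of_le_of_ne hb0 (Ne.symm hne), lt_of_le_of_lt hbρ hρ.2⟩
    linarith
  have haz : a = 1 := by
    rcases lt_trichotomy a θ with h | h | h
    · have := hf.neg a ⟨lt_of_lt_of_le hρ.1 haρ, h⟩
      linarith
    · exfalso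
      have he := lim_energy hμ hfc hKt hK₁ hu hvc hanti h01 hv hb ha hbt
      have h1 : 0 ≤ c * ∫ x, v x ^ 2 := mul_nonneg hc.le (integral_nonneg fun x => sq_nonneg _)
      have h2 : 0 < ∫ s in (0:ℝ)..θ, (-f s) := by
        apply intervalIntegral.intervalIntegral_pos_of_pos_on
          (hfc.neg.intervalIntegrable _ _) _ hf.θ_mem.1
        intro s hs
        exact neg_pos.2 (hf.neg s hs)
      rw [intervalIntegral.integral_neg] at h2
      rw [hbz, h] at he
      linarith
    · by_contra hne
      have := hf.pos a ⟨h, lt_of_le_of_ne ha1 hne⟩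
      linarith
  exact ⟨haz ▸ ha, hbz ▸ hbt⟩

/-- construction of the bistable front by passing to the limit
(Lemmas 4.6 and 4.7). -/
theorem bistable_front_construction
    (μ : Measure ℝ) (hμ : LevyMeasure μ) (hinf : μ Set.univ = ⊤)
    (f : ℝ → ℝ) (θ : ℝ) (hf : Bistable f θ)
    (hint : 0 < ∫ s in (0:ℝ)..1, f s)
    (ρ : ℝ) (hρ : ρ ∈ Set.Ioo (0 : ℝ) θ)
    (ε₀ : ℝ) (hε₀ : ε₀ ∈ Set.Ioc (0 : ℝ) 1)
    (cl cu : ℝ) (hcl : 0 < cl) (hclu : cl ≤ cu)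
    (cε : ℝ → ℝ) (uε : ℝ → ℝ → ℝ)
    (hc : ∀ ε ∈ Set.Ioc (0 : ℝ) ε₀, cε ε ∈ Set.Icc cl cu)
    (hu2 : ∀ ε ∈ Set.Ioc (0 : ℝ) ε₀, ContDiff ℝ 2 (uε ε))
    (hub : ∀ ε ∈ Set.Ioc (0 : ℝ) ε₀, ∃ M : ℝ, ∀ x, |uε ε x| ≤ M)
    (hua : ∀ ε ∈ Set.Ioc (0 : ℝ) ε₀, Antitone (uε ε))
    (hu0 : ∀ ε ∈ Set.Ioc (0 : ℝ) ε₀, uε ε 0 = ρ)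
    (heq : ∀ ε ∈ Set.Ioc (0 : ℝ) ε₀, ∀ x, -(cε ε) * deriv (uε ε) x
      = (∫ z in {z : ℝ | ε ≤ |z|}, (uε ε (x + z) - uε ε x) ∂μ) + f (uε ε x))
    (hlb : ∀ ε ∈ Set.Ioc (0 : ℝ) ε₀, Tendsto (uε ε) atBot (𝓝 (1 : ℝ)))
    (hlt : ∀ ε ∈ Set.Ioc (0 : ℝ) ε₀, Tendsto (uε ε) atTop (𝓝 (0 : ℝ))) :
    ∃ (εn : ℕ → ℝ) (c : ℝ) (u : ℝ → ℝ),
      (∀ n, εn n ∈ Set.Ioc (0 : ℝ) ε₀) ∧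
      Tendsto εn atTop (𝓝 (0 : ℝ)) ∧
      0 < c ∧
      Antitone u ∧
      ContDiff ℝ 1 u ∧
      u 0 = ρ ∧
      Tendsto (fun n => cε (εn n)) atTop (𝓝 c) ∧
      (∀ K : Set ℝ, IsCompact K →
        TendstoUniformlyOn (fun n => uε (εn n)) u atTop K ∧
        TendstoUniformlyOn (fun n => deriv (uε (εn n))) (deriv u) atTop K) ∧
      (∀ᵐ x ∂(volume : Measure ℝ),
        ∃ L : ℝ, HasPV μ u x L ∧ L + c * deriv u x + f (u x) = 0) ∧
      Tendsto u atBot (𝓝 (1 : ℝ)) ∧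
      Tendsto u atTop (𝓝 (0 : ℝ)) := by
  obtain ⟨hε₀p, hε₀1⟩ := hε₀
  -- bounds for the nonlinearity
  obtain ⟨B, hB⟩ := isCompact_Icc.exists_bound_of_continuousOn (s := Icc (0:ℝ) 1)
    ((hf.smooth.continuous_deriv le_rfl).continuousOn)
  have hB' : ∀ s ∈ Icc (0:ℝ) 1, |deriv f s| ≤ B := fun s hs => hB s hs
  set m := ∫ s in (0:ℝ)..1, f s with hm
  -- the sequence of truncations
  set e : ℕ → ℝ := fun n => ε₀ / ((n : ℝ) + 1) with he
  have hepos : ∀ n, 0 < e n := fun n => by simp only [he]; positivity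
  have hemem : ∀ n, e n ∈ Ioc (0 : ℝ) ε₀ := fun n => by
    refine ⟨hepos n, ?_⟩
    simp only [he]
    rw [div_le_iff₀ (by positivity)]
    nlinarith [(Nat.cast_nonneg n : (0:ℝ) ≤ n)]
  have het : Tendsto e atTop (𝓝 0) := by
    have h := (tendsto_one_div_add_atTop_nhds_zero_nat (𝕜 := ℝ)).const_mul ε₀
    simpa [he, div_eq_mul_inv] using h
  have h01 : ∀ n x, uε (e n) x ∈ Icc (0:ℝ) 1 := fun n x =>
    ⟨(hua _ (hemem n)).le_of_tendsto (hlt _ (hemem n)) x,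
      (hua _ (hemem n)).ge_of_tendsto (hlb _ (hemem n)) x⟩
  have hcp : ∀ n, 0 < cε (e n) := fun n => lt_of_lt_of_le hcl (hc _ (hemem n)).1
  have hap := fun n => by
    have := fin_restrict hμ (hepos n)
    exact apriori (sym_ge hμ (e n)) hf.smooth (hcp n) hB' (hu2 _ (hemem n)) (hua _ (hemem n))
      (h01 n) (heq _ (hemem n)) (hlb _ (hemem n)) (hlt _ (hemem n))
  set K1 := m / cl with hK1
  set K2 := B ^ 2 / cl ^ 2 * (m / cl) with hK2
  have hK1le : ∀ n, m / cε (e n) ≤ K1 := fun n => by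
    have := (hc _ (hemem n)).1
    simp only [hK1]; gcongr
  have hK2le : ∀ n, B ^ 2 / cε (e n) ^ 2 * (m / cε (e n)) ≤ K2 := fun n => by
    have h1 := (hc _ (hemem n)).1
    have := hcp n
    simp only [hK2]; gcongr
  have hud : ∀ n x, HasDerivAt (uε (e n)) (deriv (uε (e n)) x) x := fun n x =>
    (((hu2 _ (hemem n)).differentiable (by norm_num)) x).hasDerivAt
  have huc : ∀ n, Continuous (uε (e n)) := fun n => (hu2 _ (hemem n)).continuous
  have hvc : ∀ n, Continuous (deriv (uε (e n))) := fun n =>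
    (hu2 _ (hemem n)).continuous_deriv (by norm_num)
  have hM : ∀ n x, |deriv (uε (e n)) x| ≤ Real.sqrt (K1 + K2) := fun n x =>
    Real.abs_le_sqrt (((hap n).2.2.2.2.1 x).trans (add_le_add (hK1le n) (hK2le n)))
  have hH : ∀ n x y, |deriv (uε (e n)) y - deriv (uε (e n)) x| ≤ Real.sqrt (K2 * |y - x|) := by
    intro n x y
    have key : ∀ x y, x ≤ y → (deriv (uε (e n)) y - deriv (uε (e n)) x) ^ 2 ≤ K2 * |y - x| :=
      fun x y hxy => by
        refine ((hap n).2.2.2.2.2 x y hxy).trans ?_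
        rw [abs_of_nonneg (sub_nonneg.2 hxy)]
        exact mul_le_mul_of_nonneg_right (hK2le n) (sub_nonneg.2 hxy)
    apply Real.abs_le_sqrt
    rcases le_total x y with h | h
    · exact key x y h
    · rw [abs_sub_comm, ← neg_sq, neg_sub]
      exact key y x h
  obtain ⟨φ, hφ, V, C, hC, hVc, hcC, hVp, hVu⟩ := extract (fun n => deriv (uε (e n)))
    (fun n => cε (e n)) hM hH (fun n => hc _ (hemem n))
  set u : ℝ → ℝ := fun x => ρ + ∫ t in (0:ℝ)..x, V t with hu
  have huD : ∀ x, HasDerivAt u (V x) x := fun x =>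
    (intervalIntegral.integral_hasDerivAt_right (hVc.intervalIntegrable _ _)
      (hVc.stronglyMeasurableAtFilter _ _) hVc.continuousAt).const_add ρ
  have hucont : Continuous u := continuous_iff_continuousAt.2 fun x => (huD x).continuousAt
  have hu00 : u 0 = ρ := by simp [hu]
  have hderiv : deriv u = V := funext fun x => (huD x).deriv
  have hunif : ∀ S : Set ℝ, IsCompact S →
      TendstoUniformlyOn (fun n => uε (e (φ n))) u atTop S := fun S hS =>
    unif_prim (v := fun n => deriv (uε (e (φ n)))) (fun n => hvc _) hVc (fun n x => hud _ x) huD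
      (fun n => by rw [hu00]; exact hu0 _ (hemem _)) hVu S hS
  have hup : ∀ x, Tendsto (fun n => uε (e (φ n)) x) atTop (𝓝 (u x)) := fun x =>
    (hunif {x} isCompact_singleton).tendsto_at (mem_singleton x)
  have hanti : Antitone u := fun x y hxy =>
    le_of_tendsto_of_tendsto' (hup y) (hup x) fun n => hua _ (hemem _) hxy
  have hu01 : ∀ x, u x ∈ Icc (0:ℝ) 1 := fun x =>
    ⟨ge_of_tendsto' (hup x) fun n => (h01 _ x).1, le_of_tendsto' (hup x) fun n => (h01 _ x).2⟩
  have hCpos : 0 < C := lt_of_lt_of_le hcl hC.1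
  have hKn : ∀ n z, ∫⁻ x, ‖uε (e n) (x + z) + uε (e n) (x - z) - 2 * uε (e n) x‖ₑ ^ 2
      ≤ ‖z‖ₑ ^ 4 * ENNReal.ofReal K2 := fun n z => by
    refine (aux_second _ _ _ (hud n) (hap n).2.1 (hap n).1 z).trans ?_
    gcongr
    exact (hap n).2.2.2.1.trans (ENNReal.ofReal_le_ofReal (hK2le n))
  have hKu : ∀ z, ∫⁻ x, ‖u (x + z) + u (x - z) - 2 * u x‖ₑ ^ 2
      ≤ ‖z‖ₑ ^ 4 * ENNReal.ofReal K2 := fun z =>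
    fatou_sq (g := fun n x => uε (e (φ n)) (x + z) + uε (e (φ n)) (x - z) - 2 * uε (e (φ n)) x)
      (fun n => by have := huc (φ n); fun_prop)
      (fun x => ((hup _).add (hup _)).sub ((hup x).const_mul 2))
      (Eventually.of_forall fun n => hKn _ z)
  have hV2 : ∫⁻ x, ‖V x‖ₑ ^ 2 ≤ ENNReal.ofReal K1 :=
    fatou_sq (g := fun n => deriv (uε (e (φ n)))) (fun n => hvc _) hVp
      (Eventually.of_forall fun n =>
        (hap (φ n)).2.2.1.le.trans (ENNReal.ofReal_le_ofReal (hK1le _)))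
  have hb : ∀ δ : ℝ, 0 < δ → δ ≤ 1 → ∫⁻ x, ‖-C * V x - f (u x) - Dtrunc μ u δ x‖ₑ ^ 2 ≤
      (∫⁻ z in {z : ℝ | |z| < δ}, ‖z‖ₑ ^ 2 ∂μ) ^ 2 * ENNReal.ofReal K2 := fun δ h0 h1 =>
    lim_bound hμ hf.smooth.continuous (cn := fun n => cε (e (φ n))) (εn := fun n => e (φ n))
      (un := fun n => uε (e (φ n))) (vn := fun n => deriv (uε (e (φ n))))
      (fun n => hepos _) (het.comp hφ.tendsto_atTop) hcC (fun n => huc _) (fun n => h01 _)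
      (fun n x => heq _ (hemem _) x) (fun n => hKn _) hup hVp h0 h1
  have hends := lim_ends hμ hf hCpos hρ ENNReal.ofReal_ne_top ENNReal.ofReal_ne_top huD hVc hanti
    hu01 hu00 hV2 hb
  refine ⟨fun n => e (φ n), C, u, fun n => hemem _, het.comp hφ.tendsto_atTop, hCpos, hanti,
    ?_, hu00, hcC, fun S hS => ⟨hunif S hS, ?_⟩, ?_, hends.1, hends.2⟩
  · rw [contDiff_one_iff_deriv, hderiv]
    exact ⟨fun x => (huD x).differentiableAt, hVc⟩
  · rw [hderiv]; exact hVu S hS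
  · rw [hderiv]
    exact lim_ae hμ hf.smooth.continuous ENNReal.ofReal_ne_top hucont hVc hu01 hKu hb
end
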